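/- arXiv:math/9906118 — 3 statements merged into one kernel-verified Lean document; each statement's English description precedes it below -/
import Mathlib

section
/- Let q ∈ L¹((0,∞);ℝ) and let A be the A-function of q. Then A − q is continuous on [0,∞), it satisfies |A(α) − q(α)| ≤ Q(α)² exp(α Q(α)) for all α > 0, and for every κ > ‖q‖_{L¹(0,∞)}/2 the principal m-function of q satisfies m(−κ²) = −κ − ∫₀^∞ A(α) e^{−2ακ} dα. Moreover, if q̃ ∈ L¹((0,∞);ℝ) is a second potential with A-function Ã, then for all α > 0, |(A(α) − q(α)) − (Ã(α) − q̃(α))| ≤ (∫₀^α |q(y) − q̃(y)| dy) · (Q(α) + Q̃(α)) · exp(α(Q(α) + Q̃(α))). -/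
open MeasureTheory Set Filter
open scoped ENNReal

noncomputable section

/-- `Q(α) = ∫₀^α |q(y)| dy`. -/
def Qfun (q : ℝ → ℝ) (α : ℝ) : ℝ := ∫ y in Ioc (0:ℝ) α, |q y|

/-- The region `R_n(α)` for `n = k + 2`, as a subset of
`ℝ^{2n-2} = (Fin n → ℝ) × (Fin (n-2) → ℝ)`. -/
def Rregion (k : ℕ) (α : ℝ) : Set ((Fin (k+2) → ℝ) × (Fin k → ℝ)) :=
  {p | (∀ i, 0 ≤ p.1 i) ∧
    (∀ i : Fin k,
      |p.1 (Fin.castLE (by omega) i) - p.1 (Fin.castLE (by omega) i.succ)| ≤ p.2 i ∧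
      p.2 i ≤ p.1 (Fin.castLE (by omega) i) + p.1 (Fin.castLE (by omega) i.succ)) ∧
    |p.1 ⟨k, by omega⟩ - p.1 ⟨k+1, by omega⟩| ≤
        2*α - p.1 ⟨0, by omega⟩ - p.1 ⟨k+1, by omega⟩ - ∑ j, p.2 j ∧
      2*α - p.1 ⟨0, by omega⟩ - p.1 ⟨k+1, by omega⟩ - ∑ j, p.2 j ≤
        p.1 ⟨k, by omega⟩ + p.1 ⟨k+1, by omega⟩}

/-- `A_n(α; q)`, defined for `n ≥ 2` (for `n < 2` the value is irrelevant). -/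
def An (q : ℝ → ℝ) (n : ℕ) (α : ℝ) : ℝ :=
  ((-1 : ℝ)^(n-1) / 2^(n-2)) * ∫ p in Rregion (n-2) α, ∏ i, q (p.1 i)

/-- The `A`-function of `q`:  `A(α) = q(α) + ∑_{n=2}^∞ A_n(α)`. -/
def Afun (q : ℝ → ℝ) (α : ℝ) : ℝ := q α + ∑' k : ℕ, An q (k+2) α

/-- `u` (with derivative `v`) is a not-identically-zero twice-differentiable solution of
`-u'' + q u = -κ² u` on `(0,∞)` with `u(0) ≠ 0` which is square-integrable on `(0,∞)`;
the value of the principal `m`-function at `-κ²` is `v 0 / u 0`. -/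
def IsSolutionHalfLine (q : ℝ → ℝ) (κ : ℝ) (u v : ℝ → ℝ) : Prop :=
  u 0 ≠ 0 ∧
  (∀ x ∈ Ici (0:ℝ), HasDerivWithinAt u (v x) (Ici 0) x) ∧
  (∀ x ∈ Ioi (0:ℝ), HasDerivAt v ((q x + κ^2) * u x) x) ∧
  IntegrableOn (fun x => (u x)^2) (Ioi 0)

/-! ### Integrals over `Fin (n + 1) → ℝ` -/

theorem measurePreserving_finCons (n : ℕ) :
    MeasurePreserving (fun p : ℝ × (Fin n → ℝ) => (Fin.cons p.1 p.2 : Fin (n+1) → ℝ)) := by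
  have h := (volume_preserving_piFinSuccAbove (fun _ : Fin (n+1) => ℝ) 0).symm _
  convert! h using 1
  funext p
  simp [MeasurableEquiv.piFinSuccAbove_symm_apply, Fin.insertNthEquiv]

theorem integral_finCons {n : ℕ} (f : (Fin (n+1) → ℝ) → ℝ) :
    ∫ x, f x = ∫ p : ℝ × (Fin n → ℝ), f (Fin.cons p.1 p.2) := by
  have h := ((volume_preserving_piFinSuccAbove (fun _ : Fin (n+1) => ℝ) 0).symm _).integral_comp' f
  rw [← h]
  congr 1
  funext p
  simp [MeasurableEquiv.piFinSuccAbove_symm_apply, Fin.insertNthEquiv]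

theorem integrable_finCons {n : ℕ} {f : (Fin (n+1) → ℝ) → ℝ} (hf : Integrable f) :
    Integrable (fun p : ℝ × (Fin n → ℝ) => f (Fin.cons p.1 p.2)) :=
  (measurePreserving_finCons n).integrable_comp_of_integrable hf

/-! ### The corner simplex -/

/-- The simplex `{ℓ | ℓ i ≥ 0, ∑ ℓ i ≤ t}`. -/
def cornerSimplex (k : ℕ) (t : ℝ) : Set (Fin k → ℝ) :=
  {l | (∀ i, 0 ≤ l i) ∧ ∑ i, l i ≤ t}

theorem isClosed_cornerSimplex (k : ℕ) (t : ℝ) : IsClosed (cornerSimplex k t) := by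
  simp only [cornerSimplex, Set.ofPred_and, Set.ofPred_forall]
  refine (isClosed_iInter fun i => isClosed_le (by fun_prop) (by fun_prop)).inter
    (isClosed_le (by fun_prop) (by fun_prop))

theorem volume_cornerSimplex_lt_top (k : ℕ) (t : ℝ) : volume (cornerSimplex k t) < ⊤ := by
  refine (measure_mono (t := Icc 0 (fun _ => t)) ?_).trans_lt isCompact_Icc.measure_lt_top
  rintro l ⟨h0, h1⟩
  exact ⟨h0, fun i => (Finset.single_le_sum (fun j _ => h0 j) (Finset.mem_univ i)).trans h1⟩

theorem volume_real_cornerSimplex (k : ℕ) : ∀ t : ℝ, 0 ≤ t →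
    volume.real (cornerSimplex k t) = t ^ k / (k.factorial : ℝ) := by
  induction k with
  | zero =>
    intro t ht
    have : cornerSimplex 0 t = univ := by
      ext l; simp [cornerSimplex, ht]
    rw [this, measureReal_def, volume_pi, Measure.pi_of_empty]
    simp
  | succ k ih =>
    intro t ht
    have hm : MeasurableSet (cornerSimplex (k+1) t) := (isClosed_cornerSimplex _ _).measurableSet
    rw [← integral_indicator_one hm, integral_finCons, Measure.volume_eq_prod, integral_prod]
    · have h1 : ∀ s : ℝ, ∫ y : Fin k → ℝ,
          (cornerSimplex (k+1) t).indicator (1 : (Fin (k+1) → ℝ) → ℝ) (Fin.cons s y) =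
          (Icc 0 t).indicator (fun s => (t - s) ^ k / (k.factorial : ℝ)) s := by
        intro s
        by_cases hs : s ∈ Icc 0 t
        · rw [indicator_of_mem hs, ← ih (t - s) (by linarith [hs.2]),
            ← integral_indicator_one (isClosed_cornerSimplex _ _).measurableSet]
          congr 1
          funext y
          have hiff : (Fin.cons s y : Fin (k+1) → ℝ) ∈ cornerSimplex (k+1) t ↔
              y ∈ cornerSimplex k (t - s) := by
            simp only [cornerSimplex, Set.mem_ofPred_eq, Fin.forall_fin_succ, Fin.sum_univ_succ,
              Fin.cons_zero, Fin.cons_succ, hs.1, true_and]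
            constructor <;> rintro ⟨a, b⟩ <;> exact ⟨a, by linarith⟩
          by_cases hy : y ∈ cornerSimplex k (t - s)
          · rw [indicator_of_mem hy, indicator_of_mem (hiff.2 hy)]
            rfl
          · rw [indicator_of_notMem hy, indicator_of_notMem (mt hiff.1 hy)]
        · rw [indicator_of_notMem hs]
          convert integral_zero (Fin k → ℝ) ℝ
          refine indicator_of_notMem ?_ _
          rintro ⟨h0, h1⟩
          apply hs
          have hy := fun i => h0 (Fin.succ i)
          have := h0 0
          simp only [Fin.sum_univ_succ, Fin.cons_zero, Fin.cons_succ] at this h1 hy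
          have := Finset.sum_nonneg (fun i (_ : i ∈ Finset.univ) => hy i)
          exact ⟨by linarith, by linarith⟩
      simp only [h1]
      rw [integral_indicator measurableSet_Icc, integral_Icc_eq_integral_Ioc,
        ← intervalIntegral.integral_of_le ht]
      rw [intervalIntegral.integral_comp_sub_left (fun s => s ^ k / (k.factorial : ℝ)) t]
      simp only [sub_self, sub_zero, intervalIntegral.integral_div, integral_pow]
      rw [Nat.factorial_succ]
      push_cast
      field_simp
      ring
    · refine integrable_finCons (f := (cornerSimplex (k+1) t).indicator 1) ?_
      exact (integrable_indicator_iff hm).2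
        (integrableOn_const (volume_cornerSimplex_lt_top _ _).ne)

/-! ### Geometry of the region -/

theorem Rregion_bounds {k : ℕ} {α : ℝ} {p : (Fin (k+2) → ℝ) × (Fin k → ℝ)}
    (hp : p ∈ Rregion k α) : (∀ i, p.1 i ∈ Icc 0 α) ∧ p.2 ∈ cornerSimplex k (2 * α) := by
  obtain ⟨h0, h1, h2, h3⟩ := hp
  have hl : ∀ i, 0 ≤ p.2 i := fun i => (abs_nonneg _).trans (h1 i).1
  refine ⟨fun i => ⟨h0 i, ?_⟩, hl, ?_⟩
  · let X : ℕ → ℝ := fun m => if h : m < k + 2 then p.1 ⟨m, h⟩ else 0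
    let L : ℕ → ℝ := fun m => if h : m < k then p.2 ⟨m, h⟩ else
      2*α - p.1 ⟨0, by omega⟩ - p.1 ⟨k+1, by omega⟩ - ∑ j, p.2 j
    have hX : ∀ m (h : m < k + 2), X m = p.1 ⟨m, h⟩ := fun m h => dif_pos h
    have hd : ∀ m, m < k + 1 → dist (X m) (X (m+1)) ≤ L m := by
      intro m hm
      rw [Real.dist_eq, hX m (by omega), hX (m+1) (by omega)]
      by_cases h : m < k
      · simp only [L, dif_pos h]
        exact (h1 ⟨m, h⟩).1
      · obtain rfl : m = k := by omega
        simpa only [L, dif_neg h] using h2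
    have hL : ∑ m ∈ Finset.range (k+1), L m = 2*α - X 0 - X (k+1) := by
      rw [Finset.sum_range_succ, Finset.sum_range]
      simp only [L, Fin.is_lt, dif_pos, lt_irrefl, dif_neg, not_false_eq_true]
      rw [hX 0 (by omega), hX (k+1) (by omega)]
      ring
    have e1 := dist_le_Ico_sum_of_dist_le (f := X) (Nat.zero_le i.1) (d := L)
      (fun {m} _ hm => hd m (by omega))
    have e2 := dist_le_Ico_sum_of_dist_le (f := X) (show i.1 ≤ k + 1 by omega) (d := L)
      (fun {m} _ hm => hd m (by omega))
    have e3 := Finset.sum_Ico_consecutive L (Nat.zero_le i.1) (show i.1 ≤ k + 1 by omega)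
    rw [Finset.range_eq_Ico] at hL
    rw [hL] at e3
    rw [Real.dist_eq] at e1 e2
    have a1 := (abs_le.1 e1).1
    have a2 := (abs_le.1 e2).2
    have : p.1 i = X i := (hX i i.2).symm
    linarith
  · have := (abs_nonneg _).trans h2
    have := h0 ⟨0, by omega⟩
    have := h0 ⟨k+1, by omega⟩
    linarith

theorem measurableSet_Rregion_prod (k : ℕ) :
    MeasurableSet {z : ℝ × ((Fin (k+2) → ℝ) × (Fin k → ℝ)) | z.2 ∈ Rregion k z.1} := by
  refine IsClosed.measurableSet ?_
  change IsClosed {z : ℝ × ((Fin (k+2) → ℝ) × (Fin k → ℝ)) | (∀ i, 0 ≤ z.2.1 i) ∧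
    (∀ i : Fin k,
      |z.2.1 (Fin.castLE (by omega) i) - z.2.1 (Fin.castLE (by omega) i.succ)| ≤ z.2.2 i ∧
      z.2.2 i ≤ z.2.1 (Fin.castLE (by omega) i) + z.2.1 (Fin.castLE (by omega) i.succ)) ∧
    |z.2.1 ⟨k, by omega⟩ - z.2.1 ⟨k+1, by omega⟩| ≤
        2*z.1 - z.2.1 ⟨0, by omega⟩ - z.2.1 ⟨k+1, by omega⟩ - ∑ j, z.2.2 j ∧
      2*z.1 - z.2.1 ⟨0, by omega⟩ - z.2.1 ⟨k+1, by omega⟩ - ∑ j, z.2.2 j ≤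
        z.2.1 ⟨k, by omega⟩ + z.2.1 ⟨k+1, by omega⟩}
  simp only [Set.ofPred_and, Set.ofPred_forall]
  refine (isClosed_iInter fun i => isClosed_le (by fun_prop) (by fun_prop)).inter
    ((isClosed_iInter fun i => (isClosed_le (by fun_prop) (by fun_prop)).inter
      (isClosed_le (by fun_prop) (by fun_prop))).inter
    ((isClosed_le (by fun_prop) (by fun_prop)).inter (isClosed_le (by fun_prop) (by fun_prop))))

theorem measurableSet_Rregion (k : ℕ) (α : ℝ) : MeasurableSet (Rregion k α) :=
  measurable_prodMk_left (measurableSet_Rregion_prod k)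

/-! ### Integral bounds -/

theorem integrable_prod_coord {f : ℝ → ℝ} (hf : Integrable f) (n : ℕ) :
    Integrable (fun x : Fin n → ℝ => ∏ i, f (x i)) :=
  Integrable.fintype_prod (f := fun _ => f) (fun _ => hf)

theorem integral_abs_prod_sub_prod_le {f g : ℝ → ℝ} (hf : Integrable f) (hg : Integrable g)
    (n : ℕ) :
    ∫ x : Fin (n+1) → ℝ, |∏ i, f (x i) - ∏ i, g (x i)| ≤
      (∫ y, |f y - g y|) * ((∫ y, |f y|) + ∫ y, |g y|) ^ n := by
  induction n with
  | zero =>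
    rw [integral_finCons, Measure.volume_eq_prod]
    simp only [Fin.prod_univ_succ, Fin.cons_zero, Finset.univ_eq_empty, Finset.prod_empty, mul_one,
      pow_zero]
    have := integral_prod_mul (μ := volume) (ν := (volume : Measure (Fin 0 → ℝ)))
      (fun y => |f y - g y|) (fun _ => (1:ℝ))
    simp only [mul_one] at this
    rw [this]
    simp [measureReal_def, volume_pi]
  | succ n ih =>
    have hF := integrable_prod_coord hf (n+1)
    have hG := integrable_prod_coord hg (n+1)
    have hFG : Integrable (fun x : Fin (n+1) → ℝ => |∏ i, f (x i) - ∏ i, g (x i)|) :=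
      (hF.sub hG).abs
    have hfg : Integrable (fun y => |f y - g y|) := (hf.sub hg).abs
    have i1 := hfg.mul_prod hF.abs
    have i2 := hg.abs.mul_prod hFG
    have hf0 : 0 ≤ ∫ y, |f y| := integral_nonneg fun _ => abs_nonneg _
    have hg0 : 0 ≤ ∫ y, |g y| := integral_nonneg fun _ => abs_nonneg _
    have hd0 : 0 ≤ ∫ y, |f y - g y| := integral_nonneg fun _ => abs_nonneg _
    rw [integral_finCons, Measure.volume_eq_prod]
    calc ∫ p : ℝ × (Fin (n+1) → ℝ), |∏ i, f ((Fin.cons p.1 p.2 : Fin (n+2) → ℝ) i) -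
            ∏ i, g ((Fin.cons p.1 p.2 : Fin (n+2) → ℝ) i)| ∂(volume.prod volume)
        ≤ ∫ p : ℝ × (Fin (n+1) → ℝ), (|f p.1 - g p.1| * |∏ i, f (p.2 i)| +
            |g p.1| * |∏ i, f (p.2 i) - ∏ i, g (p.2 i)|) ∂(volume.prod volume) := by
          refine integral_mono_of_nonneg (Eventually.of_forall fun _ => abs_nonneg _)
            (i1.add i2) (Eventually.of_forall fun p => ?_)
          simp only [Fin.prod_univ_succ (n := n + 1), Fin.cons_zero, Fin.cons_succ]
          rw [← abs_mul, ← abs_mul]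
          refine le_trans (le_of_eq ?_) (abs_add_le _ _)
          congr 1
          ring
      _ = (∫ y, |f y - g y|) * (∫ y, |f y|) ^ (n+1) +
            (∫ y, |g y|) * ∫ x : Fin (n+1) → ℝ, |∏ i, f (x i) - ∏ i, g (x i)| := by
          rw [integral_add i1 i2]
          congr 1
          · refine (integral_prod_mul (fun y => |f y - g y|)
              (fun x : Fin (n+1) → ℝ => |∏ i, f (x i)|)).trans ?_
            simp only [Finset.abs_prod]
            rw [integral_fintype_prod_volume_eq_pow (fun y => |f y|)]
            simp
          · exact integral_prod_mul (fun y => |g y|)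
              (fun x : Fin (n+1) → ℝ => |∏ i, f (x i) - ∏ i, g (x i)|)
      _ ≤ (∫ y, |f y - g y|) * ((∫ y, |f y|) * ((∫ y, |f y|) + ∫ y, |g y|) ^ n) +
            (∫ y, |g y|) * ((∫ y, |f y - g y|) * ((∫ y, |f y|) + ∫ y, |g y|) ^ n) := by
          rw [pow_succ']
          gcongr
          linarith
      _ = _ := by ring

/-- The dominating function on the region. -/
theorem integrable_prod_mul_simplex {f : ℝ → ℝ} (hf : Integrable f) (k : ℕ) (t : ℝ) :
    Integrable (fun p : (Fin (k+2) → ℝ) × (Fin k → ℝ) =>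
      (∏ i, f (p.1 i)) * (cornerSimplex k t).indicator (fun _ => (1:ℝ)) p.2) := by
  have h : Integrable ((cornerSimplex k t).indicator (fun _ => (1:ℝ))) :=
    (integrable_indicator_iff (isClosed_cornerSimplex k t).measurableSet).2
      (integrableOn_const (volume_cornerSimplex_lt_top k t).ne)
  exact (integrable_prod_coord hf (k+2)).mul_prod h

theorem prod_eq_on_Rregion {q : ℝ → ℝ} {k : ℕ} {α : ℝ} {p : (Fin (k+2) → ℝ) × (Fin k → ℝ)}
    (hp : p ∈ Rregion k α) :
    ∏ i, q (p.1 i) = (∏ i, (Icc 0 α).indicator q (p.1 i)) *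
      (cornerSimplex k (2*α)).indicator (fun _ => (1:ℝ)) p.2 := by
  have h := Rregion_bounds hp
  rw [indicator_of_mem h.2, mul_one]
  exact Finset.prod_congr rfl fun i _ => (indicator_of_mem (h.1 i) _).symm

theorem An_succ_succ (q : ℝ → ℝ) (k : ℕ) (α : ℝ) :
    An q (k+2) α = ((-1 : ℝ)^(k+1) / 2^k) * ∫ p in Rregion k α, ∏ i, q (p.1 i) := rfl

theorem integral_abs_indicator_Icc (q : ℝ → ℝ) (α : ℝ) :
    ∫ y, |(Icc 0 α).indicator q y| = ∫ y in Ioc (0:ℝ) α, |q y| := by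
  rw [← integral_Icc_eq_integral_Ioc, ← integral_indicator measurableSet_Icc]
  congr 1
  funext y
  by_cases hy : y ∈ Icc 0 α
  · rw [indicator_of_mem hy, indicator_of_mem hy]
  · rw [indicator_of_notMem hy, indicator_of_notMem hy, abs_zero]

theorem abs_An_sub_An_le {q r : ℝ → ℝ} {α : ℝ} (hα : 0 ≤ α) (hq : IntegrableOn q (Ioc 0 α))
    (hr : IntegrableOn r (Ioc 0 α)) (k : ℕ) :
    |An q (k+2) α - An r (k+2) α| ≤
      (∫ y in Ioc (0:ℝ) α, |q y - r y|) * (Qfun q α + Qfun r α) *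
        ((α * (Qfun q α + Qfun r α)) ^ k / (k.factorial : ℝ)) := by
  rw [← integrableOn_Icc_iff_integrableOn_Ioc] at hq hr
  set f := (Icc 0 α).indicator q with hfdef
  set g := (Icc 0 α).indicator r with hgdef
  have hf : Integrable f := (integrable_indicator_iff measurableSet_Icc).2 hq
  have hg : Integrable g := (integrable_indicator_iff measurableSet_Icc).2 hr
  have hR := measurableSet_Rregion k α
  have hF := integrable_prod_mul_simplex hf k (2*α)
  have hG := integrable_prod_mul_simplex hg k (2*α)
  have e1 : ∀ s : ℝ → ℝ, ∫ p in Rregion k α, ∏ i, s (p.1 i) =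
      ∫ p in Rregion k α, (∏ i, (Icc 0 α).indicator s (p.1 i)) *
        (cornerSimplex k (2*α)).indicator (fun _ => (1:ℝ)) p.2 := fun s =>
    setIntegral_congr_fun hR fun p hp => prod_eq_on_Rregion hp
  rw [An_succ_succ, An_succ_succ, e1, e1, ← hfdef, ← hgdef, ← mul_sub,
    ← integral_sub hF.integrableOn hG.integrableOn, abs_mul, abs_div, abs_pow, abs_neg, abs_one,
    one_pow, abs_of_pos (show (0:ℝ) < 2^k by positivity)]
  have hD : ∫ y, |f y - g y| = ∫ y in Ioc (0:ℝ) α, |q y - r y| := by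
    rw [← integral_abs_indicator_Icc (fun y => q y - r y) α]
    congr 1
    funext y
    exact congrArg abs (indicator_sub (Icc 0 α) q r ▸ rfl)
  set Φ : (Fin (k+2) → ℝ) × (Fin k → ℝ) → ℝ := fun p => (∏ i, f (p.1 i)) *
        (cornerSimplex k (2*α)).indicator (fun _ => (1:ℝ)) p.2 - (∏ i, g (p.1 i)) *
        (cornerSimplex k (2*α)).indicator (fun _ => (1:ℝ)) p.2 with hΦ
  have hΦi : Integrable Φ := hF.sub hG
  have key : |∫ p in Rregion k α, Φ p| ≤
      ((∫ y in Ioc (0:ℝ) α, |q y - r y|) * (Qfun q α + Qfun r α) ^ (k+1)) *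
        ((2*α)^k / (k.factorial : ℝ)) := by
    calc |∫ p in Rregion k α, Φ p| ≤ ∫ p in Rregion k α, |Φ p| := abs_integral_le_integral_abs
      _ ≤ ∫ p, |Φ p| :=
          setIntegral_le_integral hΦi.abs (Eventually.of_forall fun _ => abs_nonneg _)
      _ = ∫ p : (Fin (k+2) → ℝ) × (Fin k → ℝ), |∏ i, f (p.1 i) - ∏ i, g (p.1 i)| *
            (cornerSimplex k (2*α)).indicator (fun _ => (1:ℝ)) p.2 := by
          congr 1
          funext p
          simp only [hΦ]
          rw [← sub_mul, abs_mul]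
          congr 1
          exact abs_of_nonneg (indicator_nonneg (fun _ _ => zero_le_one) _)
      _ = (∫ x : Fin (k+2) → ℝ, |∏ i, f (x i) - ∏ i, g (x i)|) *
            ((2*α)^k / (k.factorial : ℝ)) := by
          rw [Measure.volume_eq_prod]
          refine (integral_prod_mul (fun x : Fin (k+2) → ℝ => |∏ i, f (x i) - ∏ i, g (x i)|)
            ((cornerSimplex k (2*α)).indicator (fun _ => (1:ℝ)))).trans ?_
          rw [← volume_real_cornerSimplex k (2*α) (by positivity),
            ← integral_indicator_one (isClosed_cornerSimplex _ _).measurableSet]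
          rfl
      _ ≤ _ := by
          gcongr
          refine (integral_abs_prod_sub_prod_le hf hg (k+1)).trans_eq ?_
          rw [hD, hfdef, hgdef, integral_abs_indicator_Icc, integral_abs_indicator_Icc]
          rfl
  calc _ ≤ 1 / 2^k * (((∫ y in Ioc (0:ℝ) α, |q y - r y|) * (Qfun q α + Qfun r α) ^ (k+1)) *
        ((2*α)^k / (k.factorial : ℝ))) := by gcongr
    _ = _ := by
        rw [mul_pow, mul_pow]
        field_simp
        ring

theorem An_zero (k : ℕ) (α : ℝ) : An 0 (k+2) α = 0 := by
  simp [An_succ_succ]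

theorem Qfun_zero (α : ℝ) : Qfun 0 α = 0 := by simp [Qfun]

theorem Qfun_nonneg (q : ℝ → ℝ) (α : ℝ) : 0 ≤ Qfun q α := integral_nonneg fun _ => abs_nonneg _

theorem abs_An_le {q : ℝ → ℝ} {α : ℝ} (hα : 0 ≤ α) (hq : IntegrableOn q (Ioc 0 α)) (k : ℕ) :
    |An q (k+2) α| ≤ Qfun q α * Qfun q α * ((α * Qfun q α) ^ k / (k.factorial : ℝ)) := by
  simpa [An_zero, Qfun_zero, Qfun] using
    abs_An_sub_An_le hα hq (r := 0) (integrable_zero _ _ _).integrableOn k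

theorem hasSum_pow_div_factorial (c x : ℝ) :
    HasSum (fun k : ℕ => c * (x ^ k / (k.factorial : ℝ))) (c * Real.exp x) := by
  have := NormedSpace.expSeries_div_hasSum_exp x
  rw [← Real.exp_eq_exp_ℝ] at this
  exact this.mul_left c

theorem summable_An {q : ℝ → ℝ} {α : ℝ} (hα : 0 ≤ α) (hq : IntegrableOn q (Ioc 0 α)) :
    Summable (fun k => An q (k+2) α) :=
  Summable.of_norm_bounded (hasSum_pow_div_factorial _ _).summable (abs_An_le hα hq)

theorem abs_Afun_sub_le {q r : ℝ → ℝ} {α : ℝ} (hα : 0 ≤ α) (hq : IntegrableOn q (Ioc 0 α))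
    (hr : IntegrableOn r (Ioc 0 α)) :
    |(Afun q α - q α) - (Afun r α - r α)| ≤
        (∫ y in Ioc (0:ℝ) α, |q y - r y|) * (Qfun q α + Qfun r α) *
          Real.exp (α * (Qfun q α + Qfun r α)) := by
  simp only [Afun, add_sub_cancel_left]
  rw [← (summable_An hα hq).tsum_sub (summable_An hα hr)]
  exact tsum_of_norm_bounded (hasSum_pow_div_factorial _ _)
    (fun k => (Real.norm_eq_abs _).trans_le (abs_An_sub_An_le hα hq hr k))

/-! ### Continuity -/

theorem volume_linear_level_set {E : Type*} [NormedAddCommGroup E] [NormedSpace ℝ E]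
    [MeasurableSpace E] [BorelSpace E] [FiniteDimensional ℝ E] (μ : Measure E)
    [μ.IsAddHaarMeasure] {L : E → ℝ} (hL : IsLinearMap ℝ L) {e : E} (he : L e ≠ 0) (c : ℝ) :
    μ {p | L p = c} = 0 := by
  let A : AffineSubspace ℝ E :=
    (AffineSubspace.mk' c (⊥ : Submodule ℝ ℝ)).comap (IsLinearMap.mk' L hL).toAffineMap
  have hA : ∀ p, p ∈ A ↔ L p = c := by
    intro p
    simp [A, AffineSubspace.mem_comap, AffineSubspace.mem_mk', sub_eq_zero]
  have hset : {p | L p = c} = (A : Set E) := by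
    ext p
    exact (hA p).symm
  rw [hset]
  refine Measure.addHaar_affineSubspace μ A fun htop => he ?_
  have h1 : (0 : E) ∈ A := htop ▸ AffineSubspace.mem_top ℝ E _
  have h2 : e ∈ A := htop ▸ AffineSubspace.mem_top ℝ E _
  rw [hA] at h1 h2
  rw [h2, ← h1, hL.map_zero]

theorem ae_ne_Rregion_boundary (k : ℕ) (c a b : ℝ) (hab : 0 ≤ a + b) :
    ∀ᵐ p : (Fin (k+2) → ℝ) × (Fin k → ℝ),
      c - p.1 ⟨0, by omega⟩ - p.1 ⟨k+1, by omega⟩ - ∑ j, p.2 j ≠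
        a * p.1 ⟨k, by omega⟩ + b * p.1 ⟨k+1, by omega⟩ := by
  have hL : IsLinearMap ℝ (fun p : (Fin (k+2) → ℝ) × (Fin k → ℝ) =>
      p.1 ⟨0, by omega⟩ + p.1 ⟨k+1, by omega⟩ + ∑ j, p.2 j +
        (a * p.1 ⟨k, by omega⟩ + b * p.1 ⟨k+1, by omega⟩)) := by
    constructor
    · intro x y
      simp only [Prod.fst_add, Prod.snd_add, Pi.add_apply, Finset.sum_add_distrib]
      ring
    · intro r x
      simp only [Prod.smul_fst, Prod.smul_snd, Pi.smul_apply, smul_eq_mul, ← Finset.mul_sum]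
      ring
  have : (volume : Measure ((Fin (k+2) → ℝ) × (Fin k → ℝ))).IsAddHaarMeasure :=
    Measure.prod.instIsAddHaarMeasure _ _
  have h := volume_linear_level_set (volume : Measure ((Fin (k+2) → ℝ) × (Fin k → ℝ))) hL
    (e := (fun _ => 1, fun _ => 1)) (by
      simp only [mul_one, Finset.sum_const, Finset.card_univ, Fintype.card_fin, nsmul_eq_mul]
      positivity) c
  rw [ae_iff]
  refine measure_mono_null (fun p hp => ?_) h
  rw [Set.mem_ofPred_eq, not_not] at hp
  rw [Set.mem_ofPred_eq]
  linarith

theorem mem_Rregion_of_eventually {k : ℕ} {α : ℝ} {p : (Fin (k+2) → ℝ) × (Fin k → ℝ)}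
    (h1 : 2*α - p.1 ⟨0, by omega⟩ - p.1 ⟨k+1, by omega⟩ - ∑ j, p.2 j ≠
      |p.1 ⟨k, by omega⟩ - p.1 ⟨k+1, by omega⟩|)
    (h2 : 2*α - p.1 ⟨0, by omega⟩ - p.1 ⟨k+1, by omega⟩ - ∑ j, p.2 j ≠
      p.1 ⟨k, by omega⟩ + p.1 ⟨k+1, by omega⟩) :
    ∀ᶠ β in nhds α, (p ∈ Rregion k β ↔ p ∈ Rregion k α) := by
  have hc : ContinuousAt (fun β : ℝ =>
      2*β - p.1 ⟨0, by omega⟩ - p.1 ⟨k+1, by omega⟩ - ∑ j, p.2 j) α := by fun_prop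
  have e1 : ∀ᶠ β in nhds α, (|p.1 ⟨k, by omega⟩ - p.1 ⟨k+1, by omega⟩| ≤
      2*β - p.1 ⟨0, by omega⟩ - p.1 ⟨k+1, by omega⟩ - ∑ j, p.2 j ↔
      |p.1 ⟨k, by omega⟩ - p.1 ⟨k+1, by omega⟩| ≤
      2*α - p.1 ⟨0, by omega⟩ - p.1 ⟨k+1, by omega⟩ - ∑ j, p.2 j) := by
    rcases h1.lt_or_gt with h | h
    · filter_upwards [hc.eventually_lt_const h] with β hβ
      exact iff_of_false hβ.not_ge h.not_ge
    · filter_upwards [hc.eventually_const_lt h] with β hβ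
      exact iff_of_true hβ.le h.le
  have e2 : ∀ᶠ β in nhds α, (2*β - p.1 ⟨0, by omega⟩ - p.1 ⟨k+1, by omega⟩ - ∑ j, p.2 j ≤
      p.1 ⟨k, by omega⟩ + p.1 ⟨k+1, by omega⟩ ↔
      2*α - p.1 ⟨0, by omega⟩ - p.1 ⟨k+1, by omega⟩ - ∑ j, p.2 j ≤
      p.1 ⟨k, by omega⟩ + p.1 ⟨k+1, by omega⟩) := by
    rcases h2.lt_or_gt with h | h
    · filter_upwards [hc.eventually_lt_const h] with β hβ
      exact iff_of_true hβ.le h.le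
    · filter_upwards [hc.eventually_const_lt h] with β hβ
      exact iff_of_false hβ.not_ge h.not_ge
  filter_upwards [e1, e2] with β h1 h2
  exact and_congr_right fun _ => and_congr_right fun _ => and_congr h1 h2

theorem continuous_An {q : ℝ → ℝ} (hq : ∀ α, IntegrableOn q (Ioc 0 α)) (k : ℕ) :
    Continuous (An q (k+2)) := by
  rw [continuous_iff_continuousAt]
  intro α
  have hf : Integrable ((Icc 0 (α+1)).indicator q) := by
    rw [integrable_indicator_iff measurableSet_Icc, integrableOn_Icc_iff_integrableOn_Ioc]
    exact hq _
  have hF := integrable_prod_mul_simplex hf k (2*(α+1))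
  have hev : ∀ᶠ β in nhds α, β ≤ α + 1 := (eventually_lt_nhds (lt_add_one α)).mono fun _ h => h.le
  have hind : ∀ β ≤ α + 1, (Rregion k β).indicator (fun p => ∏ i, q (p.1 i)) =
      (Rregion k β).indicator (fun p => (∏ i, (Icc 0 (α+1)).indicator q (p.1 i)) *
        (cornerSimplex k (2*(α+1))).indicator (fun _ => (1:ℝ)) p.2) := by
    intro β hβ
    refine indicator_congr fun p hp => ?_
    obtain ⟨h1, h2, h3⟩ := Rregion_bounds hp
    have hs : p.2 ∈ cornerSimplex k (2*(α+1)) := ⟨h2, h3.trans (by linarith)⟩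
    rw [indicator_of_mem hs, mul_one]
    exact Finset.prod_congr rfl fun i _ =>
      (indicator_of_mem (show p.1 i ∈ Icc 0 (α+1) from ⟨(h1 i).1, (h1 i).2.trans hβ⟩) _).symm
  have key : ContinuousAt
      (fun β => ∫ p, (Rregion k β).indicator (fun p => ∏ i, q (p.1 i)) p) α := by
    refine continuousAt_of_dominated ?_ ?_ hF.norm ?_
    · filter_upwards [hev] with β hβ
      rw [hind β hβ]
      exact hF.aestronglyMeasurable.indicator (measurableSet_Rregion k β)
    · filter_upwards [hev] with β hβ
      rw [hind β hβ]
      exact Eventually.of_forall fun p => norm_indicator_le_norm_self _ _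
    · filter_upwards [ae_ne_Rregion_boundary k (2*α) 1 (-1) (by norm_num),
        ae_ne_Rregion_boundary k (2*α) (-1) 1 (by norm_num),
        ae_ne_Rregion_boundary k (2*α) 1 1 (by norm_num)] with p h1 h2 h3
      have h := mem_Rregion_of_eventually (p := p) (α := α) (k := k) (by
        rcases abs_choice (p.1 ⟨k, by omega⟩ - p.1 ⟨k+1, by omega⟩) with h | h <;> rw [h]
        · exact fun h' => h1 (h'.trans (by ring))
        · exact fun h' => h2 (h'.trans (by ring))) (fun h' => h3 (h'.trans (by ring)))
      have hconst : ContinuousAt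
          (fun _ : ℝ => (Rregion k α).indicator (fun p => ∏ i, q (p.1 i)) p) α :=
        continuousAt_const
      refine hconst.congr (h.mono fun β hβ => ?_)
      · beta_reduce
        by_cases hp : p ∈ Rregion k α
        · rw [indicator_of_mem hp, indicator_of_mem (hβ.2 hp)]
        · rw [indicator_of_notMem hp, indicator_of_notMem (mt hβ.1 hp)]
  simp only [integral_indicator (measurableSet_Rregion k _)] at key
  exact key.const_mul _

theorem Qfun_mono {q : ℝ → ℝ} {α β : ℝ} (hq : IntegrableOn q (Ioc 0 β)) (h : α ≤ β) :
    Qfun q α ≤ Qfun q β :=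
  setIntegral_mono_set hq.norm (ae_of_all _ fun _ => abs_nonneg _)
    (Ioc_subset_Ioc_right h).eventuallyLE

theorem continuousOn_Afun_sub {q : ℝ → ℝ} (hq : ∀ α, IntegrableOn q (Ioc 0 α)) :
    ContinuousOn (fun α => Afun q α - q α) (Ici 0) := by
  simp only [Afun, add_sub_cancel_left]
  have h : ∀ M : ℝ, ContinuousOn (fun α => ∑' k : ℕ, An q (k+2) α) (Icc 0 M) := fun M => by
    refine continuousOn_tsum (fun k => (continuous_An hq k).continuousOn)
      (hasSum_pow_div_factorial (Qfun q M * Qfun q M) (M * Qfun q M)).summable ?_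
    rintro k α ⟨h0, hM⟩
    refine (abs_An_le h0 (hq α) k).trans ?_
    have h1 := Qfun_mono (hq M) hM
    have h2 := Qfun_nonneg q α
    have h3 := Qfun_nonneg q M
    have h4 := h0.trans hM
    gcongr
  intro α hα
  refine ((h (α+1)) α ⟨hα, (lt_add_one α).le⟩).mono_of_mem_nhdsWithin ?_
  exact inter_mem_nhdsWithin _ (Iic_mem_nhds (lt_add_one α))

/-! ### The free Dirichlet Green function and the Born series -/

/-- The Green function of `-d²/dx² + κ²` on the half line with a Dirichlet condition at `0`. -/
def greenK (κ x y : ℝ) : ℝ :=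
  (Real.exp (-κ * |x - y|) - Real.exp (-κ * (|x| + |y|))) / (2 * κ)

theorem greenK_nonneg {κ : ℝ} (hκ : 0 < κ) (x y : ℝ) : 0 ≤ greenK κ x y := by
  refine div_nonneg (sub_nonneg.2 (Real.exp_le_exp.2 ?_)) (by positivity)
  have := mul_le_mul_of_nonneg_left (abs_sub x y) hκ.le
  linarith

theorem greenK_le {κ : ℝ} (hκ : 0 < κ) (x y : ℝ) : greenK κ x y ≤ 1 / (2 * κ) := by
  unfold greenK
  gcongr
  have h1 : Real.exp (-κ * |x - y|) ≤ 1 :=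
    Real.exp_le_one_iff.2 (by nlinarith [abs_nonneg (x - y)])
  have h2 := Real.exp_pos (-κ * (|x| + |y|))
  linarith

theorem continuous_greenK (κ : ℝ) : Continuous (fun p : ℝ × ℝ => greenK κ p.1 p.2) := by
  unfold greenK
  fun_prop

theorem exp_neg_mul_abs_le_one {κ : ℝ} (hκ : 0 < κ) (x : ℝ) : Real.exp (-κ * |x|) ≤ 1 :=
  Real.exp_le_one_iff.2 (by nlinarith [abs_nonneg x])

/-- The terms of the Born series of the solution decaying like `e^{-κx}`, without signs. -/
def bornTerm (q : ℝ → ℝ) (κ : ℝ) : ℕ → ℝ → ℝ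
  | 0 => fun x => Real.exp (-κ * |x|)
  | j+1 => fun x => ∫ y, greenK κ x y * (q y * bornTerm q κ j y)

theorem integrable_mul_of_continuous_of_le {q h : ℝ → ℝ} (hq : Integrable q) (hc : Continuous h)
    {C : ℝ} (hb : ∀ x, |h x| ≤ C) : Integrable (fun y => q y * h y) :=
  hq.mul_bdd (c := C) hc.aestronglyMeasurable (Eventually.of_forall hb)

theorem bornTerm_spec {q : ℝ → ℝ} (hq : Integrable q) {κ : ℝ} (hκ : 0 < κ) (j : ℕ) :
    Continuous (bornTerm q κ j) ∧ ∀ x, |bornTerm q κ j x| ≤ ((∫ y, |q y|) / (2 * κ)) ^ j := by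
  induction j with
  | zero =>
    refine ⟨by unfold bornTerm; fun_prop, fun x => ?_⟩
    rw [pow_zero]
    exact (abs_of_pos (Real.exp_pos _)).trans_le (exp_neg_mul_abs_le_one hκ x)
  | succ j ih =>
    obtain ⟨hc, hb⟩ := ih
    set B := ((∫ y, |q y|) / (2 * κ)) ^ j
    have hi := integrable_mul_of_continuous_of_le hq hc hb
    have hle : ∀ x y, ‖greenK κ x y * (q y * bornTerm q κ j y)‖ ≤ 1 / (2 * κ) * (|q y| * B) := by
      intro x y
      rw [Real.norm_eq_abs, abs_mul, abs_mul, abs_of_nonneg (greenK_nonneg hκ x y)]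
      have := greenK_le hκ x y
      have := hb y
      gcongr
    have hbi : Integrable (fun y => 1 / (2 * κ) * (|q y| * B)) :=
      (hq.abs.mul_const B).const_mul _
    constructor
    · refine continuous_of_dominated (fun x => ?_) (fun x => Eventually.of_forall (hle x)) hbi
        (Eventually.of_forall fun y => ?_)
      · exact ((continuous_greenK κ).comp (by fun_prop : Continuous fun y => (x, y))
          ).aestronglyMeasurable.mul hi.aestronglyMeasurable
      · exact ((continuous_greenK κ).comp (by fun_prop : Continuous fun x => (x, y))).mul_const _
    · intro x
      refine (norm_integral_le_of_norm_le hbi (Eventually.of_forall (hle x))).trans_eq ?_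
      rw [integral_const_mul, integral_mul_const, pow_succ]
      ring

/-- The integrand of the iterated Born integral. -/
def chainKernel (κ : ℝ) (g : ℝ → ℝ) (j : ℕ) (x : Fin (j+1) → ℝ) : ℝ :=
  g (x 0) * (∏ i : Fin j, greenK κ (x i.castSucc) (x i.succ)) * Real.exp (-κ * |x (Fin.last j)|)

theorem integrable_chain {q : ℝ → ℝ} (hq : Integrable q) {κ : ℝ} (hκ : 0 < κ) {g : ℝ → ℝ}
    (hg : Continuous g) {C : ℝ} (hC : ∀ x, |g x| ≤ C) (j : ℕ) :
    Integrable (fun x : Fin (j+1) → ℝ => (∏ i, q (x i)) * chainKernel κ g j x) := by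
  refine (integrable_prod_coord hq (j+1)).mul_bdd (c := C * (∏ _i : Fin j, 1 / (2 * κ)) * 1) ?_
    (Eventually.of_forall fun x => ?_)
  · have h : ∀ i : Fin j, Continuous fun x : Fin (j+1) → ℝ =>
        greenK κ (x i.castSucc) (x i.succ) := fun i =>
      (continuous_greenK κ).comp
        (by fun_prop : Continuous fun x : Fin (j+1) → ℝ => (x i.castSucc, x i.succ))
    refine Continuous.aestronglyMeasurable ?_
    unfold chainKernel
    have := continuous_finsetProd Finset.univ fun i _ => h i
    fun_prop
  · have hC0 : 0 ≤ C := (abs_nonneg _).trans (hC 0)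
    rw [chainKernel, Real.norm_eq_abs, abs_mul, abs_mul, abs_of_pos (Real.exp_pos _),
      Finset.abs_prod]
    gcongr with i
    · exact hC _
    · rw [abs_of_nonneg (greenK_nonneg hκ _ _)]
      exact greenK_le hκ _ _
    · exact exp_neg_mul_abs_le_one hκ _

theorem integral_chain {q : ℝ → ℝ} (hq : Integrable q) {κ : ℝ} (hκ : 0 < κ) (j : ℕ) :
    ∀ {g : ℝ → ℝ}, Continuous g → ∀ {C : ℝ}, (∀ x, |g x| ≤ C) →
    ∫ x : Fin (j+1) → ℝ, (∏ i, q (x i)) * chainKernel κ g j x =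
      ∫ y, g y * (q y * bornTerm q κ j y) := by
  induction j with
  | zero =>
    intro g hg C hC
    rw [integral_finCons, Measure.volume_eq_prod]
    have := integral_prod_mul (μ := volume) (ν := (volume : Measure (Fin 0 → ℝ)))
      (fun y => g y * (q y * bornTerm q κ 0 y)) (fun _ => (1:ℝ))
    simp only [mul_one] at this
    refine Eq.trans ?_ (this.trans (by simp [measureReal_def, volume_pi]))
    congr 1
    funext p
    simp only [chainKernel, Fin.prod_univ_succ, Fin.cons_zero, Finset.univ_eq_empty,
      Finset.prod_empty, mul_one, bornTerm]
    have : (Fin.cons p.1 p.2 : Fin 1 → ℝ) (Fin.last 0) = p.1 := rfl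
    rw [this]
    ring
  | succ j ih =>
    intro g hg C hC
    have hint := integrable_finCons (integrable_chain hq hκ hg hC (j+1))
    rw [integral_finCons, Measure.volume_eq_prod]
    rw [Measure.volume_eq_prod] at hint
    rw [integral_prod _ hint]
    congr 1
    funext a
    have hga : Continuous (greenK κ a) :=
      (continuous_greenK κ).comp (by fun_prop : Continuous fun y => (a, y))
    have hgb : ∀ y, |greenK κ a y| ≤ 1 / (2 * κ) := fun y =>
      (abs_of_nonneg (greenK_nonneg hκ a y)).trans_le (greenK_le hκ a y)
    have := ih hga hgb
    rw [bornTerm]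
    beta_reduce
    rw [← this, ← integral_const_mul, ← integral_const_mul]
    congr 1
    funext x
    have e1 : ∏ i, q ((Fin.cons a x : Fin (j+2) → ℝ) i) = q a * ∏ i, q (x i) := by
      rw [Fin.prod_univ_succ]
      simp
    have e2 : chainKernel κ g (j+1) (Fin.cons a x) = g a * chainKernel κ (greenK κ a) j x := by
      unfold chainKernel
      rw [Fin.prod_univ_succ (fun i : Fin (j+1) => greenK κ ((Fin.cons a x : Fin (j+2) → ℝ)
        i.castSucc) ((Fin.cons a x : Fin (j+2) → ℝ) i.succ))]
      simp only [Fin.cons_zero, Fin.cons_succ, Fin.castSucc_zero, ← Fin.succ_castSucc,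
        ← Fin.succ_last]
      ring
    rw [e1, e2]
    ring

/-! ### Laplace transform of the terms -/

theorem integral_exp_mul_interval {c : ℝ} (hc : c ≠ 0) (a b : ℝ) :
    ∫ x in a..b, Real.exp (c * x) = (Real.exp (c * b) - Real.exp (c * a)) / c := by
  rw [intervalIntegral.integral_comp_mul_left _ hc, integral_exp, smul_eq_mul, div_eq_inv_mul]

theorem integral_Icc_indicator_exp {c : ℝ} (hc : c ≠ 0) {a b : ℝ} (hab : a ≤ b) :
    ∫ x, (Icc a b).indicator (fun x => Real.exp (c * x)) x =
      (Real.exp (c * b) - Real.exp (c * a)) / c := by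
  rw [integral_indicator measurableSet_Icc, integral_Icc_eq_integral_Ioc,
    ← intervalIntegral.integral_of_le hab, integral_exp_mul_interval hc]

theorem integrable_Icc_indicator_exp (c a b : ℝ) :
    Integrable ((Icc a b).indicator (fun x => Real.exp (c * x))) :=
  (integrable_indicator_iff measurableSet_Icc).2
    (Continuous.integrableOn_Icc (by fun_prop))

/-- The contribution of a single length variable. -/
def lengthWeight (κ a b : ℝ) : ℝ → ℝ :=
  (Icc |a - b| (a + b)).indicator (fun l => Real.exp (-κ * l))

theorem abs_sub_le_add_of_nonneg {a b : ℝ} (ha : 0 ≤ a) (hb : 0 ≤ b) : |a - b| ≤ a + b :=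
  abs_le.2 ⟨by linarith, by linarith⟩

theorem integral_lengthWeight {κ : ℝ} (hκ : 0 < κ) {a b : ℝ} (ha : 0 ≤ a) (hb : 0 ≤ b) :
    ∫ l, lengthWeight κ a b l = 2 * greenK κ a b := by
  rw [lengthWeight, integral_Icc_indicator_exp (neg_ne_zero.2 hκ.ne')
    (abs_sub_le_add_of_nonneg ha hb), greenK, abs_of_nonneg ha, abs_of_nonneg hb]
  field_simp
  ring

theorem lengthWeight_nonneg (κ a b l : ℝ) : 0 ≤ lengthWeight κ a b l :=
  indicator_nonneg (fun _ _ => (Real.exp_pos _).le) _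

/-- The weight obtained by integrating `e^{-2ακ}` over those `α` with `p ∈ R_n(α)`. -/
def regionWeight (κ : ℝ) (k : ℕ) (p : (Fin (k+2) → ℝ) × (Fin k → ℝ)) : ℝ :=
  (Real.exp (-κ * |p.1 0|) * greenK κ (p.1 ⟨k, by omega⟩) (p.1 ⟨k+1, by omega⟩) *
    Real.exp (-κ * |p.1 ⟨k+1, by omega⟩|)) *
    ∏ i : Fin k, lengthWeight κ (p.1 (Fin.castLE (by omega) i))
      (p.1 (Fin.castLE (by omega) i.succ)) (p.2 i)

/-- The function `α ↦ 1_{R_n(α)}(p) e^{-2ακ}`. -/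
def regionSlice (κ : ℝ) (k : ℕ) (p : (Fin (k+2) → ℝ) × (Fin k → ℝ)) (α : ℝ) : ℝ :=
  (Rregion k α).indicator (fun _ => Real.exp (-2*α*κ)) p

theorem regionSlice_nonneg (κ : ℝ) (k : ℕ) (p : (Fin (k+2) → ℝ) × (Fin k → ℝ)) (α : ℝ) :
    0 ≤ regionSlice κ k p α :=
  indicator_nonneg (fun _ _ => (Real.exp_pos _).le) _

theorem integral_regionSlice {κ : ℝ} (hκ : 0 < κ) (k : ℕ) {p : (Fin (k+2) → ℝ) × (Fin k → ℝ)}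
    (hp : ∀ i, 0 ≤ p.1 i) :
    Integrable (regionSlice κ k p) ∧ ∫ α, regionSlice κ k p α = regionWeight κ k p := by
  set S := p.1 ⟨0, by omega⟩ + p.1 ⟨k+1, by omega⟩ + ∑ j, p.2 j with hS
  set a := p.1 ⟨k, by omega⟩ with ha
  set b := p.1 ⟨k+1, by omega⟩ with hb
  by_cases hC : ∀ i : Fin k,
      |p.1 (Fin.castLE (by omega) i) - p.1 (Fin.castLE (by omega) i.succ)| ≤ p.2 i ∧
      p.2 i ≤ p.1 (Fin.castLE (by omega) i) + p.1 (Fin.castLE (by omega) i.succ)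
  · have hmem : ∀ α, p ∈ Rregion k α ↔ α ∈ Icc ((S + |a - b|)/2) ((S + (a + b))/2) := by
      intro α
      constructor
      · rintro ⟨-, -, h1, h2⟩
        constructor <;> linarith
      · rintro ⟨h1, h2⟩
        refine ⟨hp, hC, ?_, ?_⟩ <;> linarith
    have heq : regionSlice κ k p = (Icc ((S + |a - b|)/2) ((S + (a + b))/2)).indicator
        (fun α => Real.exp ((-2 * κ) * α)) := by
      funext α
      by_cases h : p ∈ Rregion k α
      · rw [regionSlice, indicator_of_mem h, indicator_of_mem ((hmem α).1 h)]
        congr 1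
        ring
      · rw [regionSlice, indicator_of_notMem h, indicator_of_notMem (mt (hmem α).2 h)]
    rw [heq]
    refine ⟨integrable_Icc_indicator_exp _ _ _, ?_⟩
    have hab := abs_sub_le_add_of_nonneg (hp ⟨k, by omega⟩) (hp ⟨k+1, by omega⟩)
    rw [integral_Icc_indicator_exp (by linarith) (by linarith)]
    have hw : ∏ i : Fin k, lengthWeight κ (p.1 (Fin.castLE (by omega) i))
      (p.1 (Fin.castLE (by omega) i.succ)) (p.2 i) = Real.exp (-κ * ∑ j, p.2 j) := by
      rw [Finset.mul_sum, Real.exp_sum]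
      exact Finset.prod_congr rfl fun i _ => indicator_of_mem
        (show p.2 i ∈ Icc _ _ from ⟨(hC i).1, (hC i).2⟩) _
    rw [regionWeight, hw, greenK, ← ha, ← hb, abs_of_nonneg (hp 0),
      abs_of_nonneg (hp ⟨k, by omega⟩), abs_of_nonneg (hp ⟨k+1, by omega⟩), ← ha, ← hb]
    have e1 : Real.exp (-2 * κ * ((S + |a - b|)/2)) = Real.exp (-κ * p.1 0) * Real.exp (-κ * b) *
        Real.exp (-κ * ∑ j, p.2 j) * Real.exp (-κ * |a - b|) := by
      rw [← Real.exp_add, ← Real.exp_add, ← Real.exp_add, hS]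
      congr 1
      change _ = -κ * p.1 ⟨0, by omega⟩ + _ + _ + _
      ring
    have e2 : Real.exp (-2 * κ * ((S + (a + b))/2)) = Real.exp (-κ * p.1 0) * Real.exp (-κ * b) *
        Real.exp (-κ * ∑ j, p.2 j) * Real.exp (-κ * (a + b)) := by
      rw [← Real.exp_add, ← Real.exp_add, ← Real.exp_add, hS]
      congr 1
      change _ = -κ * p.1 ⟨0, by omega⟩ + _ + _ + _
      ring
    rw [e1, e2]
    field_simp
    ring
  · have heq : regionSlice κ k p = 0 := by
      funext α
      exact indicator_of_notMem (fun h => hC h.2.1) _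
    have hw : regionWeight κ k p = 0 := by
      push Not at hC
      obtain ⟨i, hi⟩ := hC
      refine mul_eq_zero_of_right _ (Finset.prod_eq_zero (Finset.mem_univ i) ?_)
      exact indicator_of_notMem (fun h => absurd h.2 (not_le.2 (hi h.1))) _
    rw [heq, hw]
    exact ⟨integrable_zero _ _ _, integral_zero _ _⟩

/-- An integrable majorant of `lengthWeight`. -/
def lengthBound (κ : ℝ) : ℝ → ℝ := (Ici 0).indicator (fun l => Real.exp (-κ * l))

theorem lengthWeight_le_lengthBound (κ a b l : ℝ) : lengthWeight κ a b l ≤ lengthBound κ l :=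
  have hsub : Icc |a - b| (a + b) ⊆ Ici 0 := fun _ h => (abs_nonneg _).trans h.1
  indicator_le_indicator_of_subset hsub
    (fun _ => (Real.exp_pos _).le) l

theorem integrable_lengthBound {κ : ℝ} (hκ : 0 < κ) : Integrable (lengthBound κ) := by
  rw [lengthBound, integrable_indicator_iff measurableSet_Ici, integrableOn_Ici_iff_integrableOn_Ioi]
  exact exp_neg_integrableOn_Ioi 0 hκ

theorem integral_lengthBound {κ : ℝ} (hκ : 0 < κ) : ∫ l, lengthBound κ l = 1 / κ := by
  rw [lengthBound, integral_indicator measurableSet_Ici, integral_Ici_eq_integral_Ioi,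
    integral_exp_mul_Ioi (by linarith) 0]
  simp

theorem regionWeight_le {κ : ℝ} (hκ : 0 < κ) (k : ℕ) (p : (Fin (k+2) → ℝ) × (Fin k → ℝ)) :
    regionWeight κ k p ≤ 1 / (2 * κ) * ∏ i, lengthBound κ (p.2 i) := by
  have h0 := greenK_nonneg hκ (p.1 ⟨k, by omega⟩) (p.1 ⟨k+1, by omega⟩)
  have hp := Finset.prod_nonneg fun (i : Fin k) (_ : i ∈ Finset.univ) =>
    lengthWeight_nonneg κ (p.1 (Fin.castLE (by omega) i))
      (p.1 (Fin.castLE (by omega) i.succ)) (p.2 i)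
  unfold regionWeight
  gcongr with i
  · calc _ ≤ 1 * (1 / (2 * κ)) * 1 := by
          gcongr
          · exact exp_neg_mul_abs_le_one hκ _
          · exact greenK_le hκ _ _
          · exact exp_neg_mul_abs_le_one hκ _
      _ = _ := by ring
  · exact fun i _ => lengthWeight_nonneg _ _ _ _
  · exact lengthWeight_le_lengthBound _ _ _ _

theorem integrable_majorant {q : ℝ → ℝ} (hq : Integrable q) {κ : ℝ} (hκ : 0 < κ) (k : ℕ) :
    Integrable (fun p : (Fin (k+2) → ℝ) × (Fin k → ℝ) =>
      (∏ i, |q (p.1 i)|) * (1 / (2 * κ) * ∏ i, lengthBound κ (p.2 i))) ∧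
    ∫ p : (Fin (k+2) → ℝ) × (Fin k → ℝ),
      (∏ i, |q (p.1 i)|) * (1 / (2 * κ) * ∏ i, lengthBound κ (p.2 i)) =
      (∫ y, |q y|) ^ (k+2) * (1 / (2 * κ) * (1 / κ) ^ k) := by
  rw [Measure.volume_eq_prod]
  refine ⟨(integrable_prod_coord hq.abs (k+2)).mul_prod
    ((integrable_prod_coord (integrable_lengthBound hκ) k).const_mul _), ?_⟩
  rw [integral_prod_mul (fun x : Fin (k+2) → ℝ => ∏ i, |q (x i)|)
    (fun l : Fin k → ℝ => 1 / (2 * κ) * ∏ i, lengthBound κ (l i)), integral_const_mul,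
    integral_fintype_prod_volume_eq_pow (fun y => |q y|),
    integral_fintype_prod_volume_eq_pow (lengthBound κ), integral_lengthBound hκ]
  simp

/-- The integrand of the Laplace transform of `A_n`, up to a constant. -/
def laplaceIntegrand (q : ℝ → ℝ) (κ : ℝ) (k : ℕ)
    (z : ℝ × ((Fin (k+2) → ℝ) × (Fin k → ℝ))) : ℝ :=
  (∏ i, q (z.2.1 i)) * regionSlice κ k z.2 z.1

theorem laplaceIntegrand_slice {q : ℝ → ℝ} (hq0 : ∀ x < 0, q x = 0) {κ : ℝ} (hκ : 0 < κ) (k : ℕ)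
    (p : (Fin (k+2) → ℝ) × (Fin k → ℝ)) :
    Integrable (fun α => laplaceIntegrand q κ k (α, p)) ∧
    ∫ α, laplaceIntegrand q κ k (α, p) = (∏ i, q (p.1 i)) * regionWeight κ k p := by
  by_cases hp : ∀ i, 0 ≤ p.1 i
  · obtain ⟨h1, h2⟩ := integral_regionSlice hκ k hp
    exact ⟨h1.const_mul (∏ i, q (p.1 i)), by simp only [laplaceIntegrand, integral_const_mul, h2]⟩
  · push Not at hp
    obtain ⟨i, hi⟩ := hp
    have h0 : ∏ i, q (p.1 i) = 0 := Finset.prod_eq_zero (Finset.mem_univ i) (hq0 _ hi)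
    simp [laplaceIntegrand, h0]

theorem norm_laplaceIntegrand (q : ℝ → ℝ) (κ : ℝ) (k : ℕ)
    (z : ℝ × ((Fin (k+2) → ℝ) × (Fin k → ℝ))) :
    ‖laplaceIntegrand q κ k z‖ = laplaceIntegrand (fun x => |q x|) κ k z := by
  rw [laplaceIntegrand, laplaceIntegrand, Real.norm_eq_abs, abs_mul, Finset.abs_prod,
    abs_of_nonneg (regionSlice_nonneg _ _ _ _)]

theorem aestronglyMeasurable_laplaceIntegrand {q : ℝ → ℝ} (hq : Integrable q) (κ : ℝ) (k : ℕ) :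
    AEStronglyMeasurable (laplaceIntegrand q κ k) (volume.prod volume) := by
  have h1 : AEStronglyMeasurable (fun p : (Fin (k+2) → ℝ) × (Fin k → ℝ) => ∏ i, q (p.1 i))
      (volume.prod volume) := (integrable_prod_coord hq (k+2)).aestronglyMeasurable.comp_fst
  refine AEStronglyMeasurable.mul h1.comp_snd ?_
  have h2 : (fun z : ℝ × ((Fin (k+2) → ℝ) × (Fin k → ℝ)) => regionSlice κ k z.2 z.1) =
      {z | z.2 ∈ Rregion k z.1}.indicator (fun z => Real.exp (-2*z.1*κ)) := rfl
  rw [h2]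
  exact AEStronglyMeasurable.indicator (by fun_prop) (measurableSet_Rregion_prod k)

theorem integrable_laplaceIntegrand {q : ℝ → ℝ} (hq : Integrable q) (hq0 : ∀ x < 0, q x = 0)
    {κ : ℝ} (hκ : 0 < κ) (k : ℕ) :
    Integrable (laplaceIntegrand q κ k) (volume.prod volume) ∧
    ∫ z, ‖laplaceIntegrand q κ k z‖ ∂(volume.prod volume) ≤
      (∫ y, |q y|) ^ (k+2) * (1 / (2 * κ) * (1 / κ) ^ k) := by
  have hm := aestronglyMeasurable_laplaceIntegrand hq κ k
  have hq0' : ∀ x < 0, |q x| = 0 := fun x hx => by rw [hq0 x hx, abs_zero]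
  have heq : ∀ p, ∫ α, ‖laplaceIntegrand q κ k (α, p)‖ =
      (∏ i, |q (p.1 i)|) * regionWeight κ k p := by
    intro p
    simp only [norm_laplaceIntegrand]
    exact (laplaceIntegrand_slice hq0' hκ k p).2
  have hle : ∀ p, (∏ i, |q (p.1 i)|) * regionWeight κ k p ≤
      (∏ i, |q (p.1 i)|) * (1 / (2 * κ) * ∏ i, lengthBound κ (p.2 i)) := fun p =>
    mul_le_mul_of_nonneg_left (regionWeight_le hκ k p)
      (Finset.prod_nonneg fun _ _ => abs_nonneg _)
  obtain ⟨hM, hMi⟩ := integrable_majorant hq hκ k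
  have hn : Integrable (fun p => ∫ α, ‖laplaceIntegrand q κ k (α, p)‖) := by
    refine hM.mono' hm.norm.prod_swap.integral_prod_right' (Eventually.of_forall fun p => ?_)
    rw [Real.norm_of_nonneg (integral_nonneg fun _ => norm_nonneg _), heq]
    exact hle p
  have hI : Integrable (laplaceIntegrand q κ k) (volume.prod volume) :=
    (integrable_prod_iff' hm).2
      ⟨Eventually.of_forall fun p => (laplaceIntegrand_slice hq0 hκ k p).1, hn⟩
  refine ⟨hI, ?_⟩
  rw [integral_prod_symm _ hI.norm, ← hMi]
  refine integral_mono hn hM fun p => ?_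
  exact (heq p).trans_le (hle p)

theorem An_mul_exp (q : ℝ → ℝ) (κ : ℝ) (k : ℕ) (α : ℝ) :
    An q (k+2) α * Real.exp (-2*α*κ) =
      ((-1)^(k+1) / 2^k) * ∫ p, laplaceIntegrand q κ k (α, p) := by
  rw [An_succ_succ, ← integral_indicator (measurableSet_Rregion k α), mul_assoc,
    ← integral_mul_const]
  congr 2
  funext p
  by_cases h : p ∈ Rregion k α
  · simp only [laplaceIntegrand, regionSlice, indicator_of_mem h]
  · simp only [laplaceIntegrand, regionSlice, indicator_of_notMem h, zero_mul, mul_zero]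

theorem integral_prod_mul_regionWeight {q : ℝ → ℝ} (hq : Integrable q) (hq0 : ∀ x < 0, q x = 0)
    {κ : ℝ} (hκ : 0 < κ) (k : ℕ) :
    ∫ p, (∏ i, q (p.1 i)) * regionWeight κ k p =
      2^k * ∫ y, Real.exp (-κ * |y|) * (q y * bornTerm q κ (k+1) y) := by
  have hI := (integrable_laplaceIntegrand hq hq0 hκ k).1.integral_prod_right
  simp only [(laplaceIntegrand_slice hq0 hκ k _).2] at hI
  rw [Measure.volume_eq_prod] at hI ⊢
  rw [integral_prod _ hI, ← integral_chain hq hκ (k+1) (g := fun y => Real.exp (-κ * |y|))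
    (by fun_prop) (C := 1)
    (fun x => (abs_of_pos (Real.exp_pos _)).trans_le (exp_neg_mul_abs_le_one hκ x)),
    ← integral_const_mul]
  congr 1
  funext x
  by_cases hx : ∀ i, 0 ≤ x i
  · have hprod : ∫ l : Fin k → ℝ, ∏ i : Fin k, lengthWeight κ (x (Fin.castLE (by omega) i))
        (x (Fin.castLE (by omega) i.succ)) (l i) =
        2^k * ∏ i : Fin k, greenK κ (x i.castSucc.castSucc) (x i.castSucc.succ) := by
      rw [integral_fintype_prod_volume_eq_prod (fun (i : Fin k) =>
        lengthWeight κ (x (Fin.castLE (by omega) i)) (x (Fin.castLE (by omega) i.succ)))]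
      simp only [integral_lengthWeight hκ (hx _) (hx _), Finset.prod_mul_distrib,
        Finset.prod_const, Finset.card_univ, Fintype.card_fin]
      rfl
    simp only [regionWeight, integral_const_mul, hprod, chainKernel]
    rw [Fin.prod_univ_castSucc (fun i : Fin (k+1) => greenK κ (x i.castSucc) (x i.succ))]
    have e1 : (⟨k, by omega⟩ : Fin (k+2)) = (Fin.last k).castSucc := rfl
    have e2 : (⟨k+1, by omega⟩ : Fin (k+2)) = (Fin.last k).succ := rfl
    have e3 : Fin.last (k+1) = (Fin.last k).succ := rfl
    rw [e1, e2, e3]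
    ring
  · push Not at hx
    obtain ⟨i, hi⟩ := hx
    have h0 : ∏ i, q (x i) = 0 := Finset.prod_eq_zero (Finset.mem_univ i) (hq0 _ hi)
    simp [h0]

theorem integrable_An_mul_exp {q : ℝ → ℝ} (hq : Integrable q) (hq0 : ∀ x < 0, q x = 0)
    {κ : ℝ} (hκ : 0 < κ) (k : ℕ) :
    Integrable (fun α => An q (k+2) α * Real.exp (-2*α*κ)) := by
  simp only [An_mul_exp]
  exact (integrable_laplaceIntegrand hq hq0 hκ k).1.integral_prod_left.const_mul _

theorem integral_norm_An_mul_exp_le {q : ℝ → ℝ} (hq : Integrable q) (hq0 : ∀ x < 0, q x = 0)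
    {κ : ℝ} (hκ : 0 < κ) (k : ℕ) :
    ∫ α, ‖An q (k+2) α * Real.exp (-2*α*κ)‖ ≤
      (∫ y, |q y|) * ((∫ y, |q y|) / (2 * κ)) ^ (k+1) := by
  obtain ⟨hI, hle⟩ := integrable_laplaceIntegrand hq hq0 hκ k
  have hn : ∀ α, ‖An q (k+2) α * Real.exp (-2*α*κ)‖ ≤
      (1 / 2^k) * ∫ p, ‖laplaceIntegrand q κ k (α, p)‖ := by
    intro α
    rw [An_mul_exp, norm_mul, norm_div, norm_pow, norm_pow, norm_neg, norm_one, one_pow,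
      Real.norm_two]
    gcongr
    exact norm_integral_le_integral_norm _
  calc _ ≤ ∫ α, (1 / 2^k) * ∫ p, ‖laplaceIntegrand q κ k (α, p)‖ :=
        integral_mono (integrable_An_mul_exp hq hq0 hκ k).norm
          (hI.integral_norm_prod_left.const_mul _) hn
    _ ≤ (1 / 2^k) * ((∫ y, |q y|) ^ (k+2) * (1 / (2 * κ) * (1 / κ) ^ k)) := by
        rw [integral_const_mul, ← integral_prod _ hI.norm]
        gcongr
    _ = _ := by
        rw [div_pow, div_pow, mul_pow, pow_succ 2 k, pow_succ κ k]
        field_simp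
        ring

theorem integral_An_mul_exp {q : ℝ → ℝ} (hq : Integrable q) (hq0 : ∀ x < 0, q x = 0)
    {κ : ℝ} (hκ : 0 < κ) (k : ℕ) :
    ∫ α, An q (k+2) α * Real.exp (-2*α*κ) =
      (-1)^(k+1) * ∫ y, Real.exp (-κ * |y|) * (q y * bornTerm q κ (k+1) y) := by
  simp only [An_mul_exp]
  rw [integral_const_mul, integral_integral_swap (f := fun α p => laplaceIntegrand q κ k (α, p))
    (integrable_laplaceIntegrand hq hq0 hκ k).1]
  simp only [(laplaceIntegrand_slice hq0 hκ k _).2]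
  rw [integral_prod_mul_regionWeight hq hq0 hκ, ← mul_assoc]
  congr 1
  field_simp

theorem An_of_neg (q : ℝ → ℝ) (k : ℕ) {α : ℝ} (hα : α < 0) : An q (k+2) α = 0 := by
  have : Rregion k α = ∅ := eq_empty_of_forall_notMem fun p hp => by
    have := (Rregion_bounds hp).1 0
    exact absurd (this.1.trans this.2) (not_le.2 hα)
  rw [An_succ_succ, this, setIntegral_empty, mul_zero]

/-- The Laplace transform of the `A`-function is the Born series. -/
theorem hasSum_laplace_Afun {q : ℝ → ℝ} (hq : Integrable q) (hq0 : ∀ x < 0, q x = 0)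
    {κ : ℝ} (hκ : (∫ y, |q y|) / 2 < κ) :
    HasSum (fun j : ℕ => (-1)^j * ∫ y, Real.exp (-κ * |y|) * (q y * bornTerm q κ j y))
      (∫ α in Ioi (0:ℝ), Afun q α * Real.exp (-2*α*κ)) := by
  have hq1 : 0 ≤ ∫ y, |q y| := integral_nonneg fun _ => abs_nonneg _
  have hκ0 : 0 < κ := by linarith
  have hθ : (∫ y, |q y|) / (2 * κ) < 1 := by
    rw [div_lt_one (by positivity)]
    linarith
  have hθ0 : 0 ≤ (∫ y, |q y|) / (2 * κ) := by positivity
  set G : ℕ → ℝ → ℝ := fun j α => match j with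
    | 0 => q α * Real.exp (-2*α*κ)
    | k+1 => An q (k+2) α * Real.exp (-2*α*κ) with hG
  have hneg : ∀ j, ∀ α < 0, G j α = 0 := by
    rintro (_ | k) α hα
    · simp [hG, hq0 α hα]
    · simp [hG, An_of_neg q k hα]
  have hset : ∀ j, ∫ α in Ioi (0:ℝ), G j α = ∫ α, G j α := by
    intro j
    rw [← integral_Ici_eq_integral_Ioi]
    exact setIntegral_eq_integral_of_forall_compl_eq_zero fun α hα =>
      hneg j α (lt_of_not_ge hα)
  have hint : ∀ j, IntegrableOn (G j) (Ioi 0) := by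
    rintro (_ | k)
    · refine hq.integrableOn.mul_bdd (c := 1) (by fun_prop) ?_
      filter_upwards [ae_restrict_mem measurableSet_Ioi] with α hα
      rw [Real.norm_of_nonneg (Real.exp_pos _).le, Real.exp_le_one_iff]
      have : 0 < α := hα
      nlinarith
    · exact (integrable_An_mul_exp hq hq0 hκ0 k).integrableOn
  have hval : ∀ j, ∫ α in Ioi (0:ℝ), G j α =
      (-1)^j * ∫ y, Real.exp (-κ * |y|) * (q y * bornTerm q κ j y) := by
    intro j
    rw [hset]
    cases j with
    | zero =>
      rw [pow_zero, one_mul]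
      congr 1
      funext y
      rcases lt_or_ge y 0 with hy | hy
      · simp [hG, hq0 y hy]
      · have : Real.exp (-2*y*κ) = Real.exp (-κ * |y|) * Real.exp (-κ * |y|) := by
          rw [← Real.exp_add, abs_of_nonneg hy]
          congr 1
          ring
        simp only [hG, bornTerm, this]
        ring
    | succ k => exact integral_An_mul_exp hq hq0 hκ0 k
  have hsum : Summable fun j => ∫ α in Ioi (0:ℝ), ‖G j α‖ := by
    rw [← summable_nat_add_iff 1]
    refine Summable.of_nonneg_of_le (fun k => integral_nonneg fun α => norm_nonneg (G (k+1) α))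
      (fun k => ?_)
      ((summable_nat_add_iff 1).2 ((summable_geometric_of_lt_one hθ0 hθ).mul_left (∫ y, |q y|)))
    exact (setIntegral_le_integral (integrable_An_mul_exp hq hq0 hκ0 k).norm
      (Eventually.of_forall fun _ => norm_nonneg _)).trans
      (integral_norm_An_mul_exp_le hq hq0 hκ0 k)
  have hH := hasSum_integral_of_summable_integral_norm hint hsum
  simp only [hval] at hH
  have hA : ∫ α in Ioi (0:ℝ), Afun q α * Real.exp (-2*α*κ) =
      ∫ α in Ioi (0:ℝ), ∑' j, G j α := by
    refine setIntegral_congr_fun measurableSet_Ioi fun α hα => ?_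
    have hA := summable_An (le_of_lt hα) (hq.integrableOn (s := Ioc 0 α))
    have hs : Summable fun j => G j α := (summable_nat_add_iff 1).1 (hA.mul_right _)
    rw [hs.tsum_eq_zero_add, Afun, add_mul, ← tsum_mul_right]
  rwa [hA]

/-! ### Square-integrable solutions -/

theorem continuousOn_of_isSolutionHalfLine {q : ℝ → ℝ} {κ : ℝ} {u v : ℝ → ℝ}
    (h : IsSolutionHalfLine q κ u v) : ContinuousOn u (Ici 0) :=
  fun x hx => (h.2.1 x hx).continuousWithinAt

theorem continuous_comp_abs {u : ℝ → ℝ} (hu : ContinuousOn u (Ici 0)) :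
    Continuous fun x => u |x| :=
  hu.comp_continuous continuous_abs fun x => abs_nonneg x

theorem continuousOn_deriv_of_isSolutionHalfLine {q : ℝ → ℝ} (hq : Integrable q) {κ : ℝ}
    {u v : ℝ → ℝ} (h : IsSolutionHalfLine q κ u v) : ContinuousOn v (Ici 0) := by
  have hc := continuousOn_of_isSolutionHalfLine h
  have hw : ∀ a b, IntervalIntegrable (fun x => (q x + κ^2) * u |x|) volume a b := fun a b =>
    (hq.intervalIntegrable.add intervalIntegrable_const).mul_continuousOn
      (continuous_comp_abs hc).continuousOn
  have hv : ∀ x, 0 < x → v x = v 1 + ∫ y in (1:ℝ)..x, (q y + κ^2) * u |y| := by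
    intro x hx
    rw [intervalIntegral.integral_eq_sub_of_hasDerivAt (fun y hy => ?_) (hw 1 x)]
    · ring
    · have hy0 : 0 < y := (lt_min one_pos hx).trans_le hy.1
      rw [abs_of_pos hy0]
      exact h.2.2.1 y hy0
  have hL : Continuous fun x => v 1 + ∫ y in (1:ℝ)..x, (q y + κ^2) * u |y| :=
    continuous_const.add (intervalIntegral.continuous_primitive hw 1)
  have hd : HasDerivWithinAt u (v 1 + ∫ y in (1:ℝ)..0, (q y + κ^2) * u |y|) (Ici 0) 0 := by
    have hder : ∀ x ∈ Ioi (0:ℝ), HasDerivAt u (v x) x := fun x hx =>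
      (h.2.1 x (Ioi_subset_Ici_self hx)).hasDerivAt (Ici_mem_nhds hx)
    refine hasDerivWithinAt_Ici_of_tendsto_deriv (s := Ioi 0)
      (fun x hx => (hder x hx).differentiableAt.differentiableWithinAt)
      ((hc 0 self_mem_Ici).mono Ioi_subset_Ici_self) self_mem_nhdsWithin ?_
    refine (hL.tendsto 0 |>.mono_left nhdsWithin_le_nhds).congr' ?_
    filter_upwards [self_mem_nhdsWithin] with x hx
    rw [(hder x hx).deriv, hv x hx]
  have h0 := (uniqueDiffOn_Ici (0:ℝ) 0 self_mem_Ici).eq_deriv _ (h.2.1 0 self_mem_Ici) hd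
  refine hL.continuousOn.congr fun x hx => ?_
  rcases (mem_Ici.1 hx).eq_or_lt with rfl | hx'
  · exact h0
  · exact hv x hx'

/-- The solution rescaled by the exponential growth. -/
def rescaled (κ : ℝ) (u : ℝ → ℝ) (x : ℝ) : ℝ := Real.exp (-κ * |x|) * u |x|

theorem continuous_rescaled {κ : ℝ} {u : ℝ → ℝ} (hu : ContinuousOn u (Ici 0)) :
    Continuous (rescaled κ u) := by
  exact (by fun_prop : Continuous fun x => Real.exp (-κ * |x|)).mul (continuous_comp_abs hu)

theorem variation_of_constants {q : ℝ → ℝ} (hq : Integrable q) {κ : ℝ} {u v : ℝ → ℝ}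
    (h : IsSolutionHalfLine q κ u v) {x : ℝ} (hx : 0 ≤ x) :
    Real.exp (-κ * x) * (v x + κ * u x) =
      v 0 + κ * u 0 + ∫ y in (0:ℝ)..x, q y * rescaled κ u y ∧
    Real.exp (κ * x) * (v x - κ * u x) =
      v 0 - κ * u 0 + ∫ y in (0:ℝ)..x, Real.exp (2 * κ * y) * (q y * rescaled κ u y) := by
  have hcu := continuousOn_of_isSolutionHalfLine h
  have hcv := continuousOn_deriv_of_isSolutionHalfLine hq h
  have hi : IntervalIntegrable (fun y => q y * rescaled κ u y) volume 0 x :=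
    hq.intervalIntegrable.mul_continuousOn (continuous_rescaled hcu).continuousOn
  have hcu' := hcu.mono (Icc_subset_Ici_self : Icc 0 x ⊆ Ici 0)
  have hcv' := hcv.mono (Icc_subset_Ici_self : Icc 0 x ⊆ Ici 0)
  have hdu : ∀ y ∈ Ioo 0 x, HasDerivAt u (v y) y := fun y hy =>
    (h.2.1 y hy.1.le).hasDerivAt (Ici_mem_nhds hy.1)
  have hdv : ∀ y ∈ Ioo 0 x, HasDerivAt v ((q y + κ^2) * u y) y := fun y hy => h.2.2.1 y hy.1
  have hexp : ∀ c y : ℝ, HasDerivAt (fun y => Real.exp (c * y)) (Real.exp (c * y) * c) y :=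
    fun c y => by simpa using ((hasDerivAt_id y).const_mul c).exp
  constructor
  · rw [intervalIntegral.integral_eq_sub_of_hasDerivAt_of_le hx
      (f := fun y => Real.exp (-κ * y) * (v y + κ * u y)) (by fun_prop) (fun y hy => ?_) hi]
    · simp
    · refine ((hexp (-κ) y).mul ((hdv y hy).add ((hdu y hy).const_mul κ))).congr_deriv ?_
      rw [rescaled, abs_of_pos hy.1]
      simp only [Pi.add_apply]
      ring
  · rw [intervalIntegral.integral_eq_sub_of_hasDerivAt_of_le hx
      (f := fun y => Real.exp (κ * y) * (v y - κ * u y)) (by fun_prop) (fun y hy => ?_)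
      (hi.continuousOn_mul (by fun_prop))]
    · simp
    · refine ((hexp κ y).mul ((hdv y hy).sub ((hdu y hy).const_mul κ))).congr_deriv ?_
      have : Real.exp (2 * κ * y) * Real.exp (-κ * y) = Real.exp (κ * y) := by
        rw [← Real.exp_add]
        congr 1
        ring
      rw [rescaled, abs_of_pos hy.1, ← this]
      simp only [Pi.sub_apply]
      ring

theorem two_mul_rescaled {q : ℝ → ℝ} (hq : Integrable q) {κ : ℝ} {u v : ℝ → ℝ}
    (h : IsSolutionHalfLine q κ u v) {x : ℝ} (hx : 0 ≤ x) :
    2 * κ * rescaled κ u x =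
      (v 0 + κ * u 0 + ∫ y in (0:ℝ)..x, q y * rescaled κ u y) -
      (Real.exp (-2 * κ * x) * (v 0 - κ * u 0) +
        ∫ y in (0:ℝ)..x, Real.exp (-2 * κ * (x - y)) * (q y * rescaled κ u y)) := by
  obtain ⟨h1, h2⟩ := variation_of_constants hq h hx
  have h3 : ∫ y in (0:ℝ)..x, Real.exp (-2 * κ * (x - y)) * (q y * rescaled κ u y) =
      Real.exp (-2 * κ * x) * ∫ y in (0:ℝ)..x, Real.exp (2 * κ * y) * (q y * rescaled κ u y) := by
    rw [← intervalIntegral.integral_const_mul]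
    congr 1
    funext y
    rw [← mul_assoc (Real.exp (-2 * κ * x)), ← Real.exp_add]
    congr 2
    ring
  have h4 : Real.exp (-2 * κ * x) * Real.exp (κ * x) = Real.exp (-κ * x) := by
    rw [← Real.exp_add]
    congr 1
    ring
  rw [h3, ← mul_add, ← h1, ← h2, ← mul_assoc, h4, rescaled, abs_of_nonneg hx]
  ring

theorem abs_rescaled_le {q : ℝ → ℝ} (hq : Integrable q) {κ : ℝ} (hκ : (∫ y, |q y|) / 2 < κ)
    {u v : ℝ → ℝ} (h : IsSolutionHalfLine q κ u v) (x : ℝ) :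
    |rescaled κ u x| ≤
      (|v 0 + κ * u 0| + |v 0 - κ * u 0|) / (2 * κ - ∫ y, |q y|) := by
  have hq1 : 0 ≤ ∫ y, |q y| := integral_nonneg fun _ => abs_nonneg _
  have hκ0 : 0 < κ := by linarith
  have hc := continuous_rescaled (κ := κ) (continuousOn_of_isSolutionHalfLine h)
  obtain ⟨s, hs, hmax⟩ := isCompact_Icc.exists_isMaxOn (nonempty_Icc.2 (abs_nonneg x))
    hc.abs.continuousOn
  have hle : |rescaled κ u x| ≤ |rescaled κ u s| := by
    have := hmax (right_mem_Icc.2 (abs_nonneg x))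
    simpa [rescaled] using this
  refine hle.trans ?_
  rw [le_div_iff₀ (by linarith)]
  have h2 := two_mul_rescaled hq h hs.1
  have hcomb : (∫ y in (0:ℝ)..s, q y * rescaled κ u y) -
      (∫ y in (0:ℝ)..s, Real.exp (-2 * κ * (s - y)) * (q y * rescaled κ u y)) =
      ∫ y in (0:ℝ)..s, (1 - Real.exp (-2 * κ * (s - y))) * (q y * rescaled κ u y) := by
    rw [← intervalIntegral.integral_sub
      (hq.intervalIntegrable.mul_continuousOn hc.continuousOn)
      ((hq.intervalIntegrable.mul_continuousOn hc.continuousOn).continuousOn_mul (by fun_prop))]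
    congr 1
    funext y
    ring
  have hbound : |∫ y in (0:ℝ)..s, (1 - Real.exp (-2 * κ * (s - y))) * (q y * rescaled κ u y)| ≤
      (∫ y, |q y|) * |rescaled κ u s| := by
    have hn : ∀ᵐ y ∂volume.restrict (Ioc 0 s),
        ‖(1 - Real.exp (-2 * κ * (s - y))) * (q y * rescaled κ u y)‖ ≤
          |q y| * |rescaled κ u s| := by
      filter_upwards [ae_restrict_mem measurableSet_Ioc] with y hy
      have he0 := Real.exp_pos (-2 * κ * (s - y))
      have he1 : Real.exp (-2 * κ * (s - y)) ≤ 1 :=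
        Real.exp_le_one_iff.2 (by nlinarith [mul_nonneg hκ0.le (sub_nonneg.2 hy.2)])
      have hm : |rescaled κ u y| ≤ |rescaled κ u s| := hmax ⟨hy.1.le, hy.2.trans hs.2⟩
      rw [Real.norm_eq_abs, abs_mul, abs_mul, abs_of_nonneg (sub_nonneg.2 he1)]
      calc _ ≤ 1 * (|q y| * |rescaled κ u s|) := by
            gcongr
            linarith
        _ = _ := one_mul _
    rw [intervalIntegral.integral_of_le hs.1, ← integral_mul_const]
    exact (norm_integral_le_of_norm_le (hq.abs.mul_const _).integrableOn hn).trans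
      (setIntegral_le_integral (hq.abs.mul_const _) (Eventually.of_forall fun y => by positivity))
  have he : |Real.exp (-2 * κ * s) * (v 0 - κ * u 0)| ≤ |v 0 - κ * u 0| := by
    rw [abs_mul, abs_of_pos (Real.exp_pos _)]
    refine mul_le_of_le_one_left (abs_nonneg _) (Real.exp_le_one_iff.2 ?_)
    nlinarith [mul_nonneg hκ0.le hs.1]
  have habs : 2 * κ * |rescaled κ u s| ≤ |v 0 + κ * u 0| + |v 0 - κ * u 0| +
      (∫ y, |q y|) * |rescaled κ u s| := by
    rw [← abs_of_pos (show 0 < 2 * κ by positivity), ← abs_mul, h2]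
    calc _ = |(v 0 + κ * u 0) - Real.exp (-2 * κ * s) * (v 0 - κ * u 0) +
          ∫ y in (0:ℝ)..s, (1 - Real.exp (-2 * κ * (s - y))) * (q y * rescaled κ u y)| := by
          rw [← hcomb]
          congr 1
          ring
      _ ≤ _ := (abs_add_le _ _).trans (add_le_add ((abs_sub _ _).trans (by gcongr)) hbound)
  linarith

theorem integrable_mul_rescaled {q : ℝ → ℝ} (hq : Integrable q) {κ : ℝ}
    (hκ : (∫ y, |q y|) / 2 < κ) {u v : ℝ → ℝ} (h : IsSolutionHalfLine q κ u v) :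
    Integrable fun y => q y * rescaled κ u y :=
  integrable_mul_of_continuous_of_le hq
    (continuous_rescaled (continuousOn_of_isSolutionHalfLine h)) (abs_rescaled_le hq hκ h)

theorem setIntegral_Ioi_eq_integral {f : ℝ → ℝ} (hf : ∀ x < 0, f x = 0) :
    ∫ x in Ioi (0:ℝ), f x = ∫ x, f x := by
  rw [← integral_Ici_eq_integral_Ioi]
  exact setIntegral_eq_integral_of_forall_compl_eq_zero fun x hx => hf x (lt_of_not_ge hx)

theorem tendsto_integral_exp_mul {f : ℝ → ℝ} (hf : Integrable f) {κ : ℝ} (hκ : 0 < κ) :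
    Tendsto (fun x => ∫ y in (0:ℝ)..x, Real.exp (-2 * κ * (x - y)) * f y) atTop (nhds 0) := by
  have key : Tendsto (fun x => ∫ y, (Ioc 0 x).indicator
      (fun y => Real.exp (-2 * κ * (x - y)) * f y) y) atTop (nhds (∫ _ : ℝ, (0:ℝ))) := by
    refine tendsto_integral_filter_of_dominated_convergence (fun y => ‖f y‖)
      (Eventually.of_forall fun x => ?_) (Eventually.of_forall fun x => Eventually.of_forall
        fun y => ?_) hf.norm (Eventually.of_forall fun y => ?_)
    · exact ((by fun_prop : Continuous fun y => Real.exp (-2 * κ * (x - y))).aestronglyMeasurable.mul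
        hf.aestronglyMeasurable).indicator measurableSet_Ioc
    · by_cases hy : y ∈ Ioc 0 x
      · rw [indicator_of_mem hy, norm_mul, Real.norm_of_nonneg (Real.exp_pos _).le]
        refine mul_le_of_le_one_left (norm_nonneg _) (Real.exp_le_one_iff.2 ?_)
        nlinarith [mul_nonneg hκ.le (sub_nonneg.2 hy.2)]
      · rw [indicator_of_notMem hy, norm_zero]
        exact norm_nonneg _
    · have h1 : Tendsto (fun x : ℝ => Real.exp (-2 * κ * (x - y)) * f y) atTop (nhds (0 * f y)) := by
        refine Tendsto.mul_const _ (Real.tendsto_exp_atBot.comp ?_)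
        exact (tendsto_atTop_add_const_right _ (-y) tendsto_id).const_mul_atTop_of_neg
          (by linarith)
      rw [zero_mul] at h1
      exact squeeze_zero_norm (a := fun x => ‖Real.exp (-2 * κ * (x - y)) * f y‖)
        (fun x => norm_indicator_le_norm_self (fun y => Real.exp (-2 * κ * (x - y)) * f y) y)
        (by simpa only [norm_zero] using h1.norm)
  rw [integral_zero] at key
  refine key.congr' ?_
  filter_upwards [eventually_ge_atTop 0] with x hx
  rw [integral_indicator measurableSet_Ioc, intervalIntegral.integral_of_le hx]

theorem tendsto_rescaled {q : ℝ → ℝ} (hq : Integrable q) (hq0 : ∀ x < 0, q x = 0) {κ : ℝ}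
    (hκ : (∫ y, |q y|) / 2 < κ) {u v : ℝ → ℝ} (h : IsSolutionHalfLine q κ u v) :
    Tendsto (fun x => 2 * κ * rescaled κ u x) atTop
      (nhds (v 0 + κ * u 0 + ∫ y, q y * rescaled κ u y)) := by
  have hκ0 : 0 < κ :=
    (div_nonneg (integral_nonneg fun _ => abs_nonneg _) two_pos.le).trans_lt hκ
  have hi := integrable_mul_rescaled hq hκ h
  have h1 := intervalIntegral_tendsto_integral_Ioi 0 hi.integrableOn tendsto_id
  rw [setIntegral_Ioi_eq_integral fun x hx => by rw [hq0 x hx, zero_mul]] at h1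
  have h2 := tendsto_integral_exp_mul hi hκ0
  have h3 : Tendsto (fun x => Real.exp (-2 * κ * x) * (v 0 - κ * u 0)) atTop
      (nhds (0 * (v 0 - κ * u 0))) :=
    Tendsto.mul_const _ (Real.tendsto_exp_atBot.comp
      (tendsto_id.const_mul_atTop_of_neg (by linarith)))
  have h4 := (h1.const_add (v 0 + κ * u 0)).sub (h3.add h2)
  rw [zero_mul, add_zero, sub_zero] at h4
  refine h4.congr' ?_
  filter_upwards [eventually_ge_atTop 0] with x hx
  exact (two_mul_rescaled hq h hx).symm

theorem deriv_zero_add_mul_eq {q : ℝ → ℝ} (hq : Integrable q) (hq0 : ∀ x < 0, q x = 0) {κ : ℝ}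
    (hκ : (∫ y, |q y|) / 2 < κ) {u v : ℝ → ℝ} (h : IsSolutionHalfLine q κ u v) :
    v 0 + κ * u 0 = -∫ y, q y * rescaled κ u y := by
  have hκ0 : 0 < κ :=
    (div_nonneg (integral_nonneg fun _ => abs_nonneg _) two_pos.le).trans_lt hκ
  have ht := (tendsto_rescaled hq hq0 hκ h).pow 2
  set c := v 0 + κ * u 0 + ∫ y, q y * rescaled κ u y with hc
  suffices c = 0 by linarith
  by_contra hne
  have hc2 : 0 < c ^ 2 := by positivity
  obtain ⟨R, hR⟩ := (ht.eventually (lt_mem_nhds (half_lt_self hc2))).exists_forall_of_atTop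
  set S := max R 0
  have hint : IntegrableOn (fun x => (2 * κ)^2 * (u x)^2) (Ioi S) :=
    (h.2.2.2.mono_set (Ioi_subset_Ioi (le_max_right _ _))).const_mul _
  have hconst : IntegrableOn (fun _ : ℝ => c ^ 2 / 2) (Ioi S) := by
    refine hint.mono' aestronglyMeasurable_const ?_
    filter_upwards [ae_restrict_mem measurableSet_Ioi] with x hx
    have hx' : S < x := hx
    have hx0 : 0 ≤ x := (le_max_right _ _).trans hx'.le
    rw [Real.norm_of_nonneg (by positivity)]
    refine (hR x ((le_max_left _ _).trans hx'.le)).le.trans ?_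
    rw [mul_pow, rescaled, abs_of_nonneg hx0, mul_pow (Real.exp _)]
    have : Real.exp (-κ * x) ^ 2 ≤ 1 :=
      pow_le_one₀ (Real.exp_pos _).le (Real.exp_le_one_iff.2 (by nlinarith))
    refine mul_le_mul_of_nonneg_left (mul_le_of_le_one_left (sq_nonneg _) this) (by positivity)
  rw [integrableOn_const_iff] at hconst
  rcases hconst with h0 | h0
  · exact absurd (enorm_eq_zero.1 h0) (half_pos hc2).ne'
  · simp at h0

theorem greenK_mul_exp_le {κ : ℝ} (hκ : 0 < κ) (x y : ℝ) :
    greenK κ x y * Real.exp (κ * |y|) ≤ Real.exp (κ * |x|) / (2 * κ) := by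
  rw [greenK, div_mul_eq_mul_div]
  gcongr
  have h1 : Real.exp (-κ * |x - y|) * Real.exp (κ * |y|) ≤ Real.exp (κ * |x|) := by
    rw [← Real.exp_add]
    refine Real.exp_le_exp.2 ?_
    have := abs_sub_abs_le_abs_sub y x
    rw [abs_sub_comm] at this
    nlinarith
  nlinarith [mul_pos (Real.exp_pos (-κ * (|x| + |y|))) (Real.exp_pos (κ * |y|))]

theorem integral_equation {q : ℝ → ℝ} (hq : Integrable q) (hq0 : ∀ x < 0, q x = 0) {κ : ℝ}
    (hκ : (∫ y, |q y|) / 2 < κ) {u v : ℝ → ℝ} (h : IsSolutionHalfLine q κ u v) (x : ℝ) :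
    u |x| = u 0 * Real.exp (-κ * |x|) - ∫ y, greenK κ |x| y * (q y * u |y|) := by
  have hκ0 : 0 < κ :=
    (div_nonneg (integral_nonneg fun _ => abs_nonneg _) two_pos.le).trans_lt hκ
  have hi := integrable_mul_rescaled hq hκ h
  set X := |x| with hX
  have hX0 : 0 ≤ X := abs_nonneg x
  obtain ⟨h1, h2⟩ := variation_of_constants hq h hX0
  have hs := deriv_zero_add_mul_eq hq hq0 hκ h
  set f := fun y => q y * rescaled κ u y with hf
  have hf0 : ∀ y < 0, f y = 0 := fun y hy => by simp [hf, hq0 y hy]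
  have hg : IntegrableOn (fun y => Real.exp (2 * κ * y) * f y) (Ioc 0 X) :=
    (intervalIntegrable_iff_integrableOn_Ioc_of_le hX0).1
      (hi.intervalIntegrable.continuousOn_mul (by fun_prop))
  have hpt : ∀ y, y ≠ 0 → 2 * κ * (greenK κ X y * (q y * u |y|)) =
      (Real.exp (κ * X) * (f y - (Ioc 0 X).indicator f y) +
        Real.exp (-κ * X) * (Ioc 0 X).indicator (fun y => Real.exp (2 * κ * y) * f y) y) -
        Real.exp (-κ * X) * f y := by
    intro y hy
    rcases hy.lt_or_gt with hy0 | hy0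
    · have hn : y ∉ Ioc 0 X := fun hm => absurd hm.1 (not_lt.2 hy0.le)
      simp [indicator_of_notMem hn, hf0 y hy0, hq0 y hy0]
    · have hfy : f y = Real.exp (-κ * y) * (q y * u y) := by
        simp only [hf, rescaled, abs_of_pos hy0]
        ring
      have e3 : Real.exp (-κ * (X + y)) = Real.exp (-κ * X) * Real.exp (-κ * y) := by
        rw [← Real.exp_add]
        congr 1
        ring
      rw [greenK, abs_of_pos hy0, abs_of_nonneg hX0, e3, hfy]
      by_cases hyX : y ≤ X
      · have hm : y ∈ Ioc 0 X := ⟨hy0, hyX⟩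
        have e1 : Real.exp (-κ * |X - y|) =
            Real.exp (-κ * X) * (Real.exp (2 * κ * y) * Real.exp (-κ * y)) := by
          rw [← Real.exp_add, ← Real.exp_add, abs_of_nonneg (sub_nonneg.2 hyX)]
          congr 1
          ring
        rw [indicator_of_mem hm, indicator_of_mem hm, hfy, e1]
        field_simp
        ring
      · have hn : y ∉ Ioc 0 X := fun hm => hyX hm.2
        have e1 : Real.exp (-κ * |X - y|) = Real.exp (κ * X) * Real.exp (-κ * y) := by
          rw [← Real.exp_add, abs_of_neg (sub_neg.2 (not_le.1 hyX))]
          congr 1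
          ring
        rw [indicator_of_notMem hn, indicator_of_notMem hn, e1]
        field_simp
        ring
  have hI1 : Integrable ((Ioc 0 X).indicator f) := hi.indicator measurableSet_Ioc
  have hI2 : Integrable ((Ioc 0 X).indicator (fun y => Real.exp (2 * κ * y) * f y)) :=
    (integrable_indicator_iff measurableSet_Ioc).2 hg
  have hI3 : Integrable fun y => f y - (Ioc 0 X).indicator f y := hi.sub hI1
  have hI4 : Integrable fun y => Real.exp (κ * X) * (f y - (Ioc 0 X).indicator f y) +
      Real.exp (-κ * X) * (Ioc 0 X).indicator (fun y => Real.exp (2 * κ * y) * f y) y :=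
    (hI3.const_mul _).add (hI2.const_mul _)
  have hae : (fun y => 2 * κ * (greenK κ X y * (q y * u |y|))) =ᵐ[volume] fun y =>
      (Real.exp (κ * X) * (f y - (Ioc 0 X).indicator f y) +
        Real.exp (-κ * X) * (Ioc 0 X).indicator (fun y => Real.exp (2 * κ * y) * f y) y) -
        Real.exp (-κ * X) * f y := by
    filter_upwards [(measure_eq_zero_iff_ae_notMem.1 (Real.volume_singleton (a := 0)))] with y hy
    exact hpt y hy
  have hsum := integral_congr_ae hae
  rw [integral_sub hI4 (hi.const_mul _), integral_add (hI3.const_mul _) (hI2.const_mul _), integral_const_mul,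
    integral_const_mul, integral_const_mul, integral_const_mul, integral_sub hi hI1,
    integral_indicator measurableSet_Ioc, integral_indicator measurableSet_Ioc,
    ← intervalIntegral.integral_of_le hX0, ← intervalIntegral.integral_of_le hX0] at hsum
  have e : Real.exp (κ * X) * Real.exp (-κ * X) = 1 := by
    rw [← Real.exp_add]
    simp
  refine mul_left_cancel₀ (show 2 * κ ≠ 0 by positivity) ?_
  rw [mul_sub, hsum]
  linear_combination (-2 * κ * u X) * e + Real.exp (κ * X) * h1 - Real.exp (-κ * X) * h2 +
    (Real.exp (κ * X) - Real.exp (-κ * X)) * hs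

/-- The remainder of the Born expansion of a solution. -/
def bornRemainder (q : ℝ → ℝ) (κ : ℝ) (u : ℝ → ℝ) (n : ℕ) (x : ℝ) : ℝ :=
  u |x| - u 0 * ∑ j ∈ Finset.range n, (-1)^j * bornTerm q κ j x

theorem integral_mul_bornRemainder {q : ℝ → ℝ} (hq : Integrable q) {κ : ℝ} (hκ : 0 < κ)
    {u : ℝ → ℝ} {g : ℝ → ℝ} (hg : Continuous g) {C : ℝ} (hC : ∀ y, |g y| ≤ C)
    (hu : Integrable fun y => g y * (q y * u |y|)) (n : ℕ) :
    ∫ y, g y * (q y * bornRemainder q κ u n y) =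
      (∫ y, g y * (q y * u |y|)) -
        u 0 * ∑ j ∈ Finset.range n, (-1)^j * ∫ y, g y * (q y * bornTerm q κ j y) := by
  have hb : ∀ j, Integrable fun y => g y * (q y * bornTerm q κ j y) := fun j =>
    (integrable_mul_of_continuous_of_le hq (bornTerm_spec hq hκ j).1
      (bornTerm_spec hq hκ j).2).bdd_mul hg.aestronglyMeasurable (Eventually.of_forall hC)
  have hs : Integrable fun y =>
      ∑ j ∈ Finset.range n, (-1)^j * (g y * (q y * bornTerm q κ j y)) :=
    integrable_finsetSum _ fun j _ => (hb j).const_mul _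
  simp only [← integral_const_mul ((-1 : ℝ) ^ _)]
  rw [← integral_finsetSum _ fun j _ => (hb j).const_mul _, ← integral_const_mul,
    ← integral_sub hu (hs.const_mul _)]
  congr 1
  funext y
  rw [bornRemainder, mul_sub, mul_sub, Finset.mul_sum, Finset.mul_sum, Finset.mul_sum,
    Finset.mul_sum]
  congr 1
  exact Finset.sum_congr rfl fun j _ => by ring

theorem abs_bornRemainder_le {q : ℝ → ℝ} (hq : Integrable q) (hq0 : ∀ x < 0, q x = 0) {κ : ℝ}
    (hκ : (∫ y, |q y|) / 2 < κ) {u v : ℝ → ℝ} (h : IsSolutionHalfLine q κ u v) {M : ℝ}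
    (hM : ∀ x, |rescaled κ u x| ≤ M) (n : ℕ) {x : ℝ} (hx : 0 ≤ x) :
    |bornRemainder q κ u n x| ≤ Real.exp (κ * |x|) * (M * ((∫ y, |q y|) / (2 * κ)) ^ n) := by
  have hκ0 : 0 < κ :=
    (div_nonneg (integral_nonneg fun _ => abs_nonneg _) two_pos.le).trans_lt hκ
  have hM0 : 0 ≤ M := (abs_nonneg _).trans (hM 0)
  have hcu := continuousOn_of_isSolutionHalfLine h
  have hur : ∀ y, u |y| = Real.exp (κ * |y|) * rescaled κ u y := by
    intro y
    rw [rescaled, ← mul_assoc, ← Real.exp_add]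
    simp
  induction n generalizing x with
  | zero =>
    rw [bornRemainder, Finset.range_zero, Finset.sum_empty, mul_zero, sub_zero, pow_zero, mul_one,
      hur, abs_mul, abs_of_pos (Real.exp_pos _)]
    exact mul_le_mul_of_nonneg_left (hM x) (Real.exp_pos _).le
  | succ n ih =>
    have hgc : Continuous (greenK κ x) :=
      (continuous_greenK κ).comp (by fun_prop : Continuous fun y => (x, y))
    have hgb : ∀ y, |greenK κ x y| ≤ 1 / (2 * κ) := fun y =>
      (abs_of_nonneg (greenK_nonneg hκ0 x y)).trans_le (greenK_le hκ0 x y)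
    have hge : ∀ y, 0 ≤ greenK κ x y * Real.exp (κ * |y|) := fun y =>
      mul_nonneg (greenK_nonneg hκ0 x y) (Real.exp_pos _).le
    have hui : Integrable fun y => greenK κ x y * (q y * u |y|) := by
      have := integrable_mul_of_continuous_of_le hq (h := fun y => greenK κ x y * u |y|)
        (C := Real.exp (κ * |x|) / (2 * κ) * M) (hgc.mul (continuous_comp_abs hcu)) fun y => by
          rw [hur, ← mul_assoc, abs_mul, abs_of_nonneg (hge y)]
          have := hM y
          have := greenK_mul_exp_le hκ0 x y
          gcongr
      exact this.congr (Eventually.of_forall fun y => by ring)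
    have hrec : bornRemainder q κ u (n+1) x =
        -∫ y, greenK κ x y * (q y * bornRemainder q κ u n y) := by
      rw [integral_mul_bornRemainder hq hκ0 hgc hgb hui, bornRemainder, Finset.sum_range_succ',
        integral_equation hq hq0 hκ h x, abs_of_nonneg hx]
      simp only [pow_succ, bornTerm, abs_of_nonneg hx, mul_neg, mul_one, neg_mul,
        Finset.sum_neg_distrib, pow_zero, one_mul]
      ring
    have hle : ∀ y, ‖greenK κ x y * (q y * bornRemainder q κ u n y)‖ ≤
        |q y| * (Real.exp (κ * |x|) / (2 * κ) * (M * ((∫ y, |q y|) / (2 * κ)) ^ n)) := by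
      intro y
      rcases lt_or_ge y 0 with hy | hy
      · simp [hq0 y hy]
      · have h1 := greenK_mul_exp_le hκ0 x y
        rw [Real.norm_eq_abs, abs_mul, abs_mul, abs_of_nonneg (greenK_nonneg hκ0 x y)]
        calc _ ≤ greenK κ x y * (|q y| *
              (Real.exp (κ * |y|) * (M * ((∫ y, |q y|) / (2 * κ)) ^ n))) := by
              have := ih hy
              have := greenK_nonneg hκ0 x y
              gcongr
          _ = |q y| * (greenK κ x y * Real.exp (κ * |y|) *
              (M * ((∫ y, |q y|) / (2 * κ)) ^ n)) := by ring
          _ ≤ _ := by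
              have : 0 ≤ ∫ y, |q y| := integral_nonneg fun _ => abs_nonneg _
              gcongr
    rw [hrec, abs_neg]
    refine (norm_integral_le_of_norm_le (hq.abs.mul_const _)
      (Eventually.of_forall hle)).trans_eq ?_
    rw [integral_mul_const, pow_succ]
    ring

theorem mFunction_eq_of_zero_on_neg {q : ℝ → ℝ} (hq : Integrable q) (hq0 : ∀ x < 0, q x = 0)
    {κ : ℝ} (hκ : (∫ y, |q y|) / 2 < κ) {u v : ℝ → ℝ} (h : IsSolutionHalfLine q κ u v) :
    v 0 / u 0 = -κ - ∫ α in Ioi (0:ℝ), Afun q α * Real.exp (-2*α*κ) := by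
  have hq1 : 0 ≤ ∫ y, |q y| := integral_nonneg fun _ => abs_nonneg _
  have hκ0 : 0 < κ := by linarith
  have hθ : (∫ y, |q y|) / (2 * κ) < 1 := by
    rw [div_lt_one (by positivity)]
    linarith
  have hθ0 : 0 ≤ (∫ y, |q y|) / (2 * κ) := by positivity
  obtain ⟨M, hM⟩ : ∃ M, ∀ x, |rescaled κ u x| ≤ M := ⟨_, abs_rescaled_le hq hκ h⟩
  have hM0 : 0 ≤ M := (abs_nonneg _).trans (hM 0)
  have hresc : (fun y => Real.exp (-κ * |y|) * (q y * u |y|)) =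
      fun y => q y * rescaled κ u y := by
    funext y
    rw [rescaled]
    ring
  have hrem : ∀ n, (∫ y, q y * rescaled κ u y) - u 0 * ∑ j ∈ Finset.range n,
      (-1)^j * ∫ y, Real.exp (-κ * |y|) * (q y * bornTerm q κ j y) =
      ∫ y, Real.exp (-κ * |y|) * (q y * bornRemainder q κ u n y) := by
    intro n
    rw [integral_mul_bornRemainder hq hκ0 (by fun_prop) (C := 1)
      (fun x => (abs_of_pos (Real.exp_pos _)).trans_le (exp_neg_mul_abs_le_one hκ0 x))
      (by rw [hresc]; exact integrable_mul_rescaled hq hκ h), hresc]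
  have hbound : ∀ n, ‖∫ y, Real.exp (-κ * |y|) * (q y * bornRemainder q κ u n y)‖ ≤
      (∫ y, |q y|) * (M * ((∫ y, |q y|) / (2 * κ)) ^ n) := by
    intro n
    rw [← integral_mul_const]
    refine norm_integral_le_of_norm_le (hq.abs.mul_const _) (Eventually.of_forall fun y => ?_)
    rcases lt_or_ge y 0 with hy | hy
    · simp [hq0 y hy]
    · rw [Real.norm_eq_abs, abs_mul, abs_mul, abs_of_pos (Real.exp_pos _)]
      calc _ ≤ Real.exp (-κ * |y|) * (|q y| *
            (Real.exp (κ * |y|) * (M * ((∫ y, |q y|) / (2 * κ)) ^ n))) := by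
            have := abs_bornRemainder_le hq hq0 hκ h hM n hy
            gcongr
        _ = (Real.exp (-κ * |y|) * Real.exp (κ * |y|)) *
            (|q y| * (M * ((∫ y, |q y|) / (2 * κ)) ^ n)) := by ring
        _ = _ := by
            rw [← Real.exp_add]
            simp
  have hlim : Tendsto (fun n => u 0 * ∑ j ∈ Finset.range n,
      (-1)^j * ∫ y, Real.exp (-κ * |y|) * (q y * bornTerm q κ j y)) atTop
      (nhds (∫ y, q y * rescaled κ u y)) := by
    have h0 : Tendsto (fun n => ∫ y, Real.exp (-κ * |y|) * (q y * bornRemainder q κ u n y))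
        atTop (nhds 0) :=
      squeeze_zero_norm hbound (by
        simpa using ((tendsto_pow_atTop_nhds_zero_of_lt_one hθ0 hθ).const_mul M).const_mul
          (∫ y, |q y|))
    have := h0.const_sub (∫ y, q y * rescaled κ u y)
    rw [sub_zero] at this
    exact this.congr fun n => by rw [← hrem n]; ring
  have hA := (hasSum_laplace_Afun hq hq0 hκ).tendsto_sum_nat.const_mul (u 0)
  have hval := tendsto_nhds_unique hA hlim
  have hs := deriv_zero_add_mul_eq hq hq0 hκ h
  rw [div_eq_iff h.1]
  linear_combination hs + hval

theorem An_indicator (q : ℝ → ℝ) (k : ℕ) (α : ℝ) :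
    An ((Ici 0).indicator q) (k+2) α = An q (k+2) α := by
  rw [An_succ_succ, An_succ_succ]
  congr 1
  refine setIntegral_congr_fun (measurableSet_Rregion k α) fun p hp => ?_
  exact Finset.prod_congr rfl fun i _ => indicator_of_mem (show p.1 i ∈ Ici 0 from hp.1 i) _

theorem mFunction_eq {q : ℝ → ℝ} (hq : IntegrableOn q (Ioi 0)) {κ : ℝ}
    (hκ : (∫ y in Ioi (0:ℝ), |q y|) / 2 < κ) {u v : ℝ → ℝ} (h : IsSolutionHalfLine q κ u v) :
    v 0 / u 0 = -κ - ∫ α in Ioi (0:ℝ), Afun q α * Real.exp (-2*α*κ) := by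
  set r := (Ici (0:ℝ)).indicator q with hr
  have hrq : ∀ x ∈ Ioi (0:ℝ), r x = q x := fun x hx =>
    indicator_of_mem (Ioi_subset_Ici_self hx) _
  have hr0 : ∀ x < 0, r x = 0 := fun x hx => indicator_of_notMem (not_le.2 hx) _
  have hri : Integrable r :=
    (integrable_indicator_iff measurableSet_Ici).2 ((integrableOn_Ici_iff_integrableOn_Ioi (by simp)).2 hq)
  have hnorm : ∫ y, |r y| = ∫ y in Ioi (0:ℝ), |q y| := by
    rw [← setIntegral_Ioi_eq_integral fun x hx => by rw [hr0 x hx, abs_zero]]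
    exact setIntegral_congr_fun measurableSet_Ioi fun x hx => by simp only [hrq x hx]
  have hsol : IsSolutionHalfLine r κ u v :=
    ⟨h.1, h.2.1, fun x hx => by rw [hrq x hx]; exact h.2.2.1 x hx, h.2.2.2⟩
  rw [mFunction_eq_of_zero_on_neg hri hr0 (by rwa [hnorm]) hsol]
  congr 1
  refine setIntegral_congr_fun measurableSet_Ioi fun α hα => ?_
  simp only [Afun, hrq α hα]
  simp only [hr, An_indicator]

/-- Theorem 2.1:  for `q ∈ L¹(0,∞)`, `A - q` is continuous on `[0,∞)`,
`|A(α) - q(α)| ≤ Q(α)² exp(α Q(α))`, for `κ > ‖q‖₁/2` one has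
`m(-κ²) = -κ - ∫₀^∞ A(α) e^{-2ακ} dα`, and the difference of the `A`-functions of two
potentials obeys the stated Lipschitz bound. -/
theorem theorem2_1 (q : ℝ → ℝ) (hq : IntegrableOn q (Ioi 0)) :
    ContinuousOn (fun α => Afun q α - q α) (Ici 0) ∧
    (∀ α : ℝ, 0 < α → |Afun q α - q α| ≤ (Qfun q α)^2 * Real.exp (α * Qfun q α)) ∧
    (∀ κ : ℝ, (∫ y in Ioi (0:ℝ), |q y|) / 2 < κ →
      ∀ u v : ℝ → ℝ, IsSolutionHalfLine q κ u v →
        v 0 / u 0 = -κ - ∫ α in Ioi (0:ℝ), Afun q α * Real.exp (-2*α*κ)) ∧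
    (∀ qt : ℝ → ℝ, IntegrableOn qt (Ioi 0) → ∀ α : ℝ, 0 < α →
      |(Afun q α - q α) - (Afun qt α - qt α)| ≤
        (∫ y in Ioc (0:ℝ) α, |q y - qt y|) * (Qfun q α + Qfun qt α) *
          Real.exp (α * (Qfun q α + Qfun qt α))) := by
  have hloc : ∀ r : ℝ → ℝ, IntegrableOn r (Ioi 0) → ∀ α, IntegrableOn r (Ioc 0 α) :=
    fun r hr α => hr.mono_set Ioc_subset_Ioi_self
  refine ⟨continuousOn_Afun_sub (hloc q hq), fun α hα => ?_,
    fun κ hκ u v h => mFunction_eq hq hκ h,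
    fun qt hqt α hα => abs_Afun_sub_le hα.le (hloc q hq α) (hloc qt hqt α)⟩
  have h0 : Afun 0 α = 0 := by simp [Afun, An_zero]
  simpa [h0, Qfun_zero, Qfun, sq] using
    abs_Afun_sub_le hα.le (hloc q hq α) (hloc 0 integrableOn_zero α)

end
end

section
/- Let q ∈ L¹((0,∞);ℝ) and n ≥ 2. Then A_n is a continuous function of α on (0,∞) and satisfies |A_n(α)| ≤ Q(α)^n α^{n−2}/(n−2)! for all α > 0. -/
open MeasureTheory Set Filter
open scoped ENNReal

noncomputable section

theorem addHaar_linear_level_set {E : Type*} [NormedAddCommGroup E] [NormedSpace ℝ E]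
    [MeasurableSpace E] [BorelSpace E] [FiniteDimensional ℝ E] (μ : Measure E)
    [μ.IsAddHaarMeasure] (L : E →ₗ[ℝ] ℝ) (hL : ∃ v, L v ≠ 0) (c : ℝ) :
    μ {x | L x = c} = 0 := by
  obtain ⟨v, hv⟩ := hL
  have key := Measure.addHaar_affineSubspace μ
    ((AffineSubspace.mk' c (⊥ : Submodule ℝ ℝ)).comap L.toAffineMap) (by
      intro h
      have h1 : ∀ x : E, L x = c := fun x ↦ by
        have hx : x ∈ (AffineSubspace.mk' c (⊥ : Submodule ℝ ℝ)).comap L.toAffineMap :=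
          h ▸ AffineSubspace.mem_top ℝ E x
        simpa [AffineSubspace.mem_mk', sub_eq_zero] using hx
      apply hv
      rw [h1 v, ← h1 0, map_zero])
  convert key using 2
  ext x
  simp [AffineSubspace.mem_mk', sub_eq_zero]

theorem volume_cornerSimplex_le (k : ℕ) {t : ℝ} (ht : 0 ≤ t) :
    volume (cornerSimplex k t) ≤ ENNReal.ofReal (t ^ k / k.factorial) := by
  induction k generalizing t with
  | zero =>
    refine (measure_mono (subset_univ _)).trans ?_
    simp [volume_pi]
  | succ k ih =>
    have hmp := (volume_preserving_piFinSuccAbove (fun _ : Fin (k + 1) ↦ ℝ) 0).symm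
    have hS := (isClosed_cornerSimplex (k + 1) t).measurableSet
    rw [← hmp.measure_preimage hS.nullMeasurableSet, Measure.volume_eq_prod,
      Measure.prod_apply (hmp.measurable hS)]
    have hle : ∀ s : ℝ, volume (Prod.mk s ⁻¹'
        ((MeasurableEquiv.piFinSuccAbove (fun _ : Fin (k + 1) ↦ ℝ) 0).symm ⁻¹'
          cornerSimplex (k + 1) t)) ≤
        (Icc 0 t).indicator (fun s ↦ ENNReal.ofReal ((t - s) ^ k / k.factorial)) s := by
      intro s
      have hsub : Prod.mk s ⁻¹'
        ((MeasurableEquiv.piFinSuccAbove (fun _ : Fin (k + 1) ↦ ℝ) 0).symm ⁻¹'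
          cornerSimplex (k + 1) t) ⊆ {l | 0 ≤ s ∧ l ∈ cornerSimplex k (t - s)} := by
        intro l hl
        simp only [cornerSimplex, mem_preimage, mem_ofPred_eq, Fin.forall_fin_succ,
          Fin.sum_univ_succ] at hl ⊢
        simp [MeasurableEquiv.piFinSuccAbove, Fin.insertNthEquiv] at hl
        exact ⟨hl.1.1, hl.1.2, by linarith⟩
      by_cases hs : s ∈ Icc 0 t
      · rw [indicator_of_mem hs]
        exact (measure_mono (hsub.trans fun l hl ↦ hl.2)).trans (ih (by linarith [hs.2]))
      · rw [indicator_of_notMem hs]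
        refine (measure_mono (hsub.trans ?_)).trans measure_empty.le
        rintro l ⟨h0, hl, hl'⟩
        exact hs ⟨h0, by linarith [Finset.sum_nonneg fun i (_ : i ∈ Finset.univ) ↦ hl i]⟩
    refine (lintegral_mono hle).trans ?_
    rw [lintegral_indicator measurableSet_Icc, ← ofReal_integral_eq_lintegral_ofReal]
    · apply ENNReal.ofReal_le_ofReal
      rw [integral_Icc_eq_integral_Ioc, ← intervalIntegral.integral_of_le ht,
        intervalIntegral.integral_comp_sub_left (fun x ↦ x ^ k / (k.factorial : ℝ)) t]
      simp only [sub_self, sub_zero, intervalIntegral.integral_div, integral_pow,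
        Nat.factorial_succ]
      push_cast
      rw [zero_pow (by omega), sub_zero, div_div, mul_comm]
    · exact (Continuous.continuousOn (by fun_prop)).integrableOn_Icc
    · refine (ae_restrict_iff' measurableSet_Icc).2 (ae_of_all _ fun s hs ↦ ?_)
      have := sub_nonneg.2 hs.2
      simp only [Pi.zero_apply]
      positivity

theorem isClosed_Rregion (k : ℕ) (α : ℝ) : IsClosed (Rregion k α) := by
  simp only [Rregion, ofPred_and, ofPred_forall]
  refine IsClosed.inter (isClosed_iInter fun i ↦ isClosed_le (by fun_prop) (by fun_prop))
    (IsClosed.inter (isClosed_iInter fun i ↦ ?_) ?_) <;>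
  exact (isClosed_le (by fun_prop) (by fun_prop)).inter (isClosed_le (by fun_prop) (by fun_prop))

theorem le_of_mem_Rregion {k : ℕ} {α : ℝ} {p : (Fin (k + 2) → ℝ) × (Fin k → ℝ)}
    (hp : p ∈ Rregion k α) (i : Fin (k + 2)) : p.1 i ≤ α := by
  obtain ⟨x, l⟩ := p
  obtain ⟨-, h, hlast, -⟩ := hp
  simp only at h hlast ⊢
  set X : ℕ → ℝ := fun m ↦ x ⟨min m k, by omega⟩ with hX
  set L : ℕ → ℝ := fun m ↦ if hm : m < k then l ⟨m, hm⟩ else 0 with hL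
  have hstep : ∀ m, |X m - X (m + 1)| ≤ L m := by
    intro m
    by_cases hm : m < k
    · have := (h ⟨m, hm⟩).1
      simp only [hX, hL, hm, dif_pos, min_eq_left hm.le, min_eq_left (Nat.succ_le_of_lt hm)]
      exact this
    · simp only [hX, hL, hm, dif_neg, not_false_eq_true, min_eq_right (not_lt.1 hm),
        min_eq_right ((not_lt.1 hm).trans (Nat.le_succ m)), sub_self, abs_zero, le_refl]
  have hsum : ∑ j, l j = ∑ m ∈ Finset.range k, L m := by
    rw [← Fin.sum_univ_eq_sum_range]
    exact Finset.sum_congr rfl fun j _ ↦ by simp [hL]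
  have hmono : Monotone fun m ↦ X m + ∑ j ∈ Finset.range m, L j :=
    monotone_nat_of_le_succ fun m ↦ by
      rw [Finset.sum_range_succ]
      linarith [(abs_le.1 (hstep m)).2]
  have hanti : Antitone fun m ↦ X m - ∑ j ∈ Finset.range m, L j :=
    antitone_nat_of_succ_le fun m ↦ by
      rw [Finset.sum_range_succ]
      linarith [(abs_le.1 (hstep m)).1]
  have h0 : X 0 = x ⟨0, by omega⟩ := by simp [hX]
  have hk : X k = x ⟨k, by omega⟩ := by simp [hX]
  rw [hsum, ← h0, ← hk] at hlast
  obtain ⟨hl1, hl2⟩ := abs_le.1 hlast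
  obtain ⟨m, hm⟩ := i
  rcases Nat.lt_succ_iff_lt_or_eq.1 hm with hm' | rfl
  · have hmk : m ≤ k := by omega
    have h1 := hmono hmk
    have h2 := hanti (Nat.zero_le m)
    have h3 : X m = x ⟨m, hm⟩ := by simp [hX, hmk]
    simp only [Finset.range_zero, Finset.sum_empty] at h1 h2
    linarith
  · have h2 := hanti (Nat.zero_le k)
    simp only [Finset.range_zero, Finset.sum_empty] at h2
    linarith

theorem snd_mem_cornerSimplex {k : ℕ} {α : ℝ} {p : (Fin (k + 2) → ℝ) × (Fin k → ℝ)}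
    (hp : p ∈ Rregion k α) : p.2 ∈ cornerSimplex k (2 * α) := by
  obtain ⟨hx, h, hlast, -⟩ := hp
  refine ⟨fun i ↦ (abs_nonneg _).trans (h i).1, ?_⟩
  linarith [hx ⟨0, by omega⟩, hx ⟨k + 1, by omega⟩, (abs_nonneg _).trans hlast]

/-- An integrable function dominating the integrand of `An q (k + 2) α` for all `α ≤ β`. -/
def majorant (q : ℝ → ℝ) (k : ℕ) (β : ℝ) (p : (Fin (k + 2) → ℝ) × (Fin k → ℝ)) : ℝ :=
  (∏ i, (Icc 0 β).indicator (fun y ↦ |q y|) (p.1 i)) *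
    (cornerSimplex k (2 * β)).indicator (fun _ ↦ (1 : ℝ)) p.2

theorem norm_indicator_Rregion_le (q : ℝ → ℝ) (k : ℕ) {α β : ℝ} (hαβ : α ≤ β)
    (p : (Fin (k + 2) → ℝ) × (Fin k → ℝ)) :
    ‖(Rregion k α).indicator (fun p ↦ ∏ i, q (p.1 i)) p‖ ≤ majorant q k β p := by
  by_cases hp : p ∈ Rregion k α
  · have h2 := snd_mem_cornerSimplex hp
    have h3 : p.2 ∈ cornerSimplex k (2 * β) := ⟨h2.1, by linarith [h2.2]⟩
    have h1 : ∀ i, p.1 i ∈ Icc 0 β := fun i ↦ ⟨hp.1 i, (le_of_mem_Rregion hp i).trans hαβ⟩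
    have h4 : ∏ i, (Icc 0 β).indicator (fun y ↦ |q y|) (p.1 i) = ∏ i, |q (p.1 i)| :=
      Finset.prod_congr rfl fun i _ ↦ indicator_of_mem (h1 i) _
    rw [majorant, h4, indicator_of_mem hp, indicator_of_mem h3, mul_one, Real.norm_eq_abs,
      Finset.abs_prod]
  · rw [indicator_of_notMem hp, norm_zero]
    exact mul_nonneg (Finset.prod_nonneg fun i _ ↦ indicator_nonneg (fun _ _ ↦ abs_nonneg _) _)
      (indicator_nonneg (fun _ _ ↦ zero_le_one) _)

theorem volume_cornerSimplex_ne_top (k : ℕ) {t : ℝ} (ht : 0 ≤ t) :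
    volume (cornerSimplex k t) ≠ ∞ :=
  ((volume_cornerSimplex_le k ht).trans_lt ENNReal.ofReal_lt_top).ne

theorem integrable_majorant_s1 {q : ℝ → ℝ} (hq : IntegrableOn q (Ioi 0)) (k : ℕ) {β : ℝ}
    (hβ : 0 ≤ β) : Integrable (majorant q k β) := by
  have hq' : Integrable ((Icc 0 β).indicator fun y ↦ |q y|) :=
    (integrable_indicator_iff measurableSet_Icc).2
      ((((integrableOn_Ici_iff_integrableOn_Ioi (by finiteness)).2 hq).mono_set Icc_subset_Ici_self).abs)
  have h1 : Integrable fun x : Fin (k + 2) → ℝ ↦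
      ∏ i, (Icc 0 β).indicator (fun y ↦ |q y|) (x i) :=
    Integrable.fintype_prod fun _ ↦ hq'
  have h2 : Integrable ((cornerSimplex k (2 * β)).indicator fun _ ↦ (1 : ℝ)) :=
    (integrable_indicator_iff (isClosed_cornerSimplex _ _).measurableSet).2
      (integrableOn_const (volume_cornerSimplex_ne_top k (by linarith)))
  exact h1.mul_prod h2

theorem integral_majorant_le (q : ℝ → ℝ) (k : ℕ) {β : ℝ} (hβ : 0 ≤ β) :
    ∫ p, majorant q k β p ≤ Qfun q β ^ (k + 2) * ((2 * β) ^ k / k.factorial) := by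
  have hQ : ∫ y, (Icc 0 β).indicator (fun y ↦ |q y|) y = Qfun q β := by
    rw [integral_indicator measurableSet_Icc, integral_Icc_eq_integral_Ioc, Qfun]
  have hQ0 : 0 ≤ Qfun q β := integral_nonneg fun _ ↦ abs_nonneg _
  have hS : ∫ l, (cornerSimplex k (2 * β)).indicator (fun _ ↦ (1 : ℝ)) l ≤
      (2 * β) ^ k / k.factorial := by
    rw [integral_indicator (isClosed_cornerSimplex _ _).measurableSet]
    simp only [integral_const, smul_eq_mul, mul_one, measureReal_restrict_apply_univ]
    exact ENNReal.toReal_le_of_le_ofReal (by positivity)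
      (volume_cornerSimplex_le k (by linarith))
  simp only [majorant]
  rw [Measure.volume_eq_prod, integral_prod_mul
    (fun x : Fin (k + 2) → ℝ ↦ ∏ i, (Icc 0 β).indicator (fun y ↦ |q y|) (x i)),
    integral_fintype_prod_volume_eq_pow, hQ, Fintype.card_fin]
  gcongr

theorem aestronglyMeasurable_indicator_Rregion {q : ℝ → ℝ} (hq : IntegrableOn q (Ioi 0))
    (k : ℕ) (α : ℝ) :
    AEStronglyMeasurable ((Rregion k α).indicator fun p ↦ ∏ i, q (p.1 i)) := by
  have hq' : Integrable ((Ici 0).indicator q) :=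
    (integrable_indicator_iff measurableSet_Ici).2
      ((integrableOn_Ici_iff_integrableOn_Ioi (by finiteness)).2 hq)
  have h1 : Integrable fun x : Fin (k + 2) → ℝ ↦ ∏ i, (Ici 0).indicator q (x i) :=
    Integrable.fintype_prod fun _ ↦ hq'
  have h2 : AEStronglyMeasurable fun p : (Fin (k + 2) → ℝ) × (Fin k → ℝ) ↦
      ∏ i, (Ici 0).indicator q (p.1 i) := h1.aestronglyMeasurable.comp_fst
  have heq : ((Rregion k α).indicator fun p ↦ ∏ i, q (p.1 i)) =
      (Rregion k α).indicator fun p ↦ ∏ i, (Ici 0).indicator q (p.1 i) :=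
    indicator_congr fun p hp ↦ Finset.prod_congr rfl fun i _ ↦
      (indicator_of_mem (show p.1 i ∈ Ici 0 from hp.1 i) q).symm
  rw [heq]
  exact h2.indicator (isClosed_Rregion k α).measurableSet

/-- Almost every point lies off the three moving hyperplanes bounding `Rregion k α`. -/
theorem ae_notMem_moving_faces (k : ℕ) (α : ℝ) :
    ∀ᵐ p : (Fin (k + 2) → ℝ) × (Fin k → ℝ),
      |p.1 ⟨k, by omega⟩ - p.1 ⟨k + 1, by omega⟩| ≠
        2 * α - p.1 ⟨0, by omega⟩ - p.1 ⟨k + 1, by omega⟩ - ∑ j, p.2 j ∧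
      2 * α - p.1 ⟨0, by omega⟩ - p.1 ⟨k + 1, by omega⟩ - ∑ j, p.2 j ≠
        p.1 ⟨k, by omega⟩ + p.1 ⟨k + 1, by omega⟩ := by
  let e (i : Fin (k + 2)) : (Fin (k + 2) → ℝ) × (Fin k → ℝ) →ₗ[ℝ] ℝ :=
    LinearMap.proj i ∘ₗ LinearMap.fst ℝ _ _
  let S : (Fin (k + 2) → ℝ) × (Fin k → ℝ) →ₗ[ℝ] ℝ :=
    (∑ j, LinearMap.proj j) ∘ₗ LinearMap.snd ℝ _ _
  have : (volume : Measure ((Fin (k + 2) → ℝ) × (Fin k → ℝ))).IsAddHaarMeasure :=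
    Measure.prod.instIsAddHaarMeasure _ _
  have hlevel (L : (Fin (k + 2) → ℝ) × (Fin k → ℝ) →ₗ[ℝ] ℝ) (hL : ∃ v, L v ≠ 0) :
      ∀ᵐ p, L p ≠ 2 * α := by
    simpa [ae_iff] using addHaar_linear_level_set volume L hL (2 * α)
  have hne : (⟨k, by omega⟩ : Fin (k + 2)) ≠ ⟨k + 1, by omega⟩ := by simp
  filter_upwards [hlevel (e ⟨0, by omega⟩ + e ⟨k, by omega⟩ + S)
      ⟨(fun _ ↦ 1, 0), by simp [e, S]⟩,
    hlevel (e ⟨0, by omega⟩ + (2 : ℝ) • e ⟨k + 1, by omega⟩ - e ⟨k, by omega⟩ + S)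
      ⟨(Pi.single ⟨k + 1, by omega⟩ 1, 0), by simp [e, S, hne]⟩,
    hlevel (e ⟨0, by omega⟩ + (2 : ℝ) • e ⟨k + 1, by omega⟩ + e ⟨k, by omega⟩ + S)
      ⟨(fun _ ↦ 1, 0), by simp [e, S]; norm_num⟩] with p h1 h2 h3
  simp only [e, S, LinearMap.add_apply, LinearMap.sub_apply, LinearMap.smul_apply, smul_eq_mul,
    LinearMap.comp_apply, LinearMap.proj_apply, LinearMap.fst_apply, LinearMap.snd_apply,
    LinearMap.sum_apply] at h1 h2 h3
  refine ⟨fun h ↦ ?_, fun h ↦ h3 (by linarith)⟩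
  rcases abs_choice (p.1 ⟨k, by omega⟩ - p.1 ⟨k + 1, by omega⟩) with h' | h' <;> rw [h'] at h
  · exact h1 (by linarith)
  · exact h2 (by linarith)

theorem eventually_le_iff_of_ne {f g : ℝ → ℝ} {a : ℝ} (hf : ContinuousAt f a)
    (hg : ContinuousAt g a) (hne : f a ≠ g a) :
    ∀ᶠ x in nhds a, (f x ≤ g x ↔ f a ≤ g a) := by
  rcases hne.lt_or_gt with h | h
  · filter_upwards [hf.eventually_lt hg h] with x hx
    exact iff_of_true hx.le h.le
  · filter_upwards [hg.eventually_lt hf h] with x hx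
    exact iff_of_false hx.not_ge h.not_ge

theorem continuousAt_integral_Rregion {q : ℝ → ℝ} (hq : IntegrableOn q (Ioi 0)) (k : ℕ)
    {α : ℝ} (hα : 0 < α) :
    ContinuousAt (fun α ↦ ∫ p in Rregion k α, ∏ i, q (p.1 i)) α := by
  simp only [← integral_indicator (isClosed_Rregion k _).measurableSet]
  refine continuousAt_of_dominated
    (Eventually.of_forall fun β ↦ aestronglyMeasurable_indicator_Rregion hq k β)
    ?_ (integrable_majorant_s1 hq k (β := α + 1) (by linarith)) ?_
  · filter_upwards [Iio_mem_nhds (lt_add_one α)] with β hβ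
    exact ae_of_all _ fun p ↦ norm_indicator_Rregion_le q k (le_of_lt hβ) p
  · filter_upwards [ae_notMem_moving_faces k α] with p hp
    have hev : ∀ᶠ β in nhds α, (p ∈ Rregion k β ↔ p ∈ Rregion k α) := by
      filter_upwards [eventually_le_iff_of_ne (f := fun _ ↦ _) (g := fun β ↦
          2 * β - p.1 ⟨0, by omega⟩ - p.1 ⟨k + 1, by omega⟩ - ∑ j, p.2 j)
          (by fun_prop) (by fun_prop) hp.1,
        eventually_le_iff_of_ne (f := fun β ↦
          2 * β - p.1 ⟨0, by omega⟩ - p.1 ⟨k + 1, by omega⟩ - ∑ j, p.2 j) (g := fun _ ↦ _)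
          (by fun_prop) (by fun_prop) hp.2] with β h1 h2
      exact and_congr_right fun _ ↦ and_congr_right fun _ ↦ and_congr h1 h2
    refine continuousAt_const.congr (f := fun _ ↦
      (Rregion k α).indicator (fun p ↦ ∏ i, q (p.1 i)) p) ?_
    filter_upwards [hev] with β hβ
    by_cases h : p ∈ Rregion k α
    · rw [indicator_of_mem h, indicator_of_mem (hβ.2 h)]
    · rw [indicator_of_notMem h, indicator_of_notMem (mt hβ.1 h)]

/-- Each `A_n` (`n ≥ 2`) is continuous on `(0,∞)` and obeys
`|A_n(α)| ≤ Q(α)^n α^{n-2}/(n-2)!`. -/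
theorem An_continuous_and_bound (q : ℝ → ℝ) (hq : IntegrableOn q (Ioi 0))
    (n : ℕ) (hn : 2 ≤ n) :
    ContinuousOn (An q n) (Ioi 0) ∧
    ∀ α : ℝ, 0 < α →
      |An q n α| ≤ Qfun q α ^ n * α ^ (n-2) / (Nat.factorial (n-2)) := by
  obtain ⟨k, rfl⟩ := Nat.exists_eq_add_of_le' hn
  refine ⟨fun α hα ↦ ?_, fun α hα ↦ ?_⟩
  · exact ((continuousAt_integral_Rregion hq k hα).const_mul _).continuousWithinAt
  · have hI : |∫ p in Rregion k α, ∏ i, q (p.1 i)| ≤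
        Qfun q α ^ (k + 2) * ((2 * α) ^ k / k.factorial) := by
      rw [← integral_indicator (isClosed_Rregion k α).measurableSet]
      exact (norm_integral_le_of_norm_le (integrable_majorant_s1 hq k hα.le)
        (ae_of_all _ (norm_indicator_Rregion_le q k le_rfl))).trans
        (integral_majorant_le q k hα.le)
    calc |An q (k + 2) α| = 1 / 2 ^ k * |∫ p in Rregion k α, ∏ i, q (p.1 i)| := by
          simp only [An, Nat.add_sub_cancel, abs_mul, abs_div, abs_pow, abs_neg, abs_one, one_pow,
            abs_two]
          rfl
      _ ≤ 1 / 2 ^ k * (Qfun q α ^ (k + 2) * ((2 * α) ^ k / k.factorial)) := by gcongr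
      _ = Qfun q α ^ (k + 2) * α ^ (k + 2 - 2) / (k + 2 - 2).factorial := by
          simp only [Nat.add_sub_cancel, mul_pow]
          field_simp

end
end

section
/- Let q, q̃ ∈ L¹((0,∞);ℝ) and n ≥ 2. Then for all α > 0, |A_n(α; q) − A_n(α; q̃)| ≤ (Q(α) + Q̃(α))^{n−1} · (∫₀^α |q(y) − q̃(y)| dy) · α^{n−2}/(n−2)!, where Q̃(α) = ∫₀^α |q̃(y)| dy and A_n(·; q), A_n(·; q̃) are the functions A_n computed from q and q̃ respectively. -/
open MeasureTheory Set Filter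
open scoped ENNReal

noncomputable section

/-- The simplex `{ℓ ≥ 0, ∑ ℓ ≤ r}` in `ℝᵏ`. -/
def orthantSimplex (k : ℕ) (r : ℝ) : Set (Fin k → ℝ) := {l | (∀ i, 0 ≤ l i) ∧ ∑ i, l i ≤ r}

lemma measurableSet_orthantSimplex (k : ℕ) (r : ℝ) : MeasurableSet (orthantSimplex k r) := by
  have h1 : MeasurableSet {l : Fin k → ℝ | ∀ i, 0 ≤ l i} := by
    rw [ofPred_forall]
    exact MeasurableSet.iInter fun i => measurableSet_le measurable_const (measurable_pi_apply i)
  have h2 : MeasurableSet {l : Fin k → ℝ | ∑ i, l i ≤ r} :=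
    measurableSet_le (Finset.measurable_fun_sum _ fun i _ => measurable_pi_apply i)
      measurable_const
  exact h1.inter h2

lemma lintegral_ofReal_sub_pow_div_factorial (k : ℕ) {r : ℝ} (hr : 0 ≤ r) :
    ∫⁻ t in Icc 0 r, ENNReal.ofReal ((r - t) ^ k / k.factorial) =
      ENNReal.ofReal (r ^ (k + 1) / (k + 1).factorial) := by
  rw [← ofReal_integral_eq_lintegral_ofReal]
  · rw [integral_Icc_eq_integral_Ioc, ← intervalIntegral.integral_of_le hr,
      intervalIntegral.integral_div,
      intervalIntegral.integral_comp_sub_left (fun t => t ^ k) r]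
    simp only [sub_self, sub_zero, integral_pow, Nat.factorial_succ]
    congr 1
    push_cast
    field_simp
    simp
  · exact (Continuous.continuousOn (by fun_prop)).integrableOn_compact isCompact_Icc
  · filter_upwards [ae_restrict_mem measurableSet_Icc] with t ht
    have : 0 ≤ r - t := sub_nonneg.2 ht.2
    positivity

lemma volume_orthantSimplex_le (k : ℕ) {r : ℝ} (hr : 0 ≤ r) :
    volume (orthantSimplex k r) ≤ ENNReal.ofReal (r ^ k / k.factorial) := by
  induction k generalizing r with
  | zero =>
    refine (measure_mono (subset_univ _)).trans ?_
    simp [volume_pi]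
  | succ k ih =>
    let e := MeasurableEquiv.piFinSuccAbove (fun _ : Fin (k + 1) => ℝ) 0
    have he : MeasurePreserving e := volume_preserving_piFinSuccAbove (fun _ => ℝ) 0
    rw [← he.symm.measure_preimage (measurableSet_orthantSimplex _ _).nullMeasurableSet,
      Measure.volume_eq_prod,
      Measure.prod_apply (e.symm.measurable (measurableSet_orthantSimplex _ _)),
      ← lintegral_ofReal_sub_pow_div_factorial k hr, ← lintegral_indicator measurableSet_Icc]
    refine lintegral_mono fun t => ?_
    by_cases ht : t ∈ Icc 0 r
    · rw [indicator_of_mem ht]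
      refine (measure_mono ?_).trans (ih (sub_nonneg.2 ht.2))
      rintro l ⟨h1, h2⟩
      refine ⟨fun i => ?_, ?_⟩
      · simpa [e] using h1 i.succ
      · rw [Fin.sum_univ_succ] at h2
        simp [e] at h2
        linarith
    · rw [indicator_of_notMem ht, nonpos_iff_eq_zero]
      convert measure_empty (μ := volume)
      refine eq_empty_of_forall_notMem fun l hl => ht ?_
      obtain ⟨h1, h2⟩ := hl
      have h3 : ∀ i, 0 ≤ l i := fun i => by simpa [e] using h1 i.succ
      rw [Fin.sum_univ_succ] at h2
      simp [e] at h2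
      have h4 := h1 0
      simp [e] at h4
      have := Finset.sum_nonneg fun i (_ : i ∈ Finset.univ) => h3 i
      exact ⟨h4, by linarith⟩

/-- The telescoping bound for the difference of two products. -/
lemma abs_prod_sub_prod_le (m : ℕ) (a b : Fin m → ℝ) :
    |∏ i, a i - ∏ i, b i| ≤
      ∑ j, ∏ i, (if i < j then |a i| else if i = j then |a i - b i| else |b i|) := by
  induction m with
  | zero => simp
  | succ m ih =>
    simp only [Fin.prod_univ_succ, Fin.sum_univ_succ]
    simp only [Fin.not_lt_zero, Fin.succ_ne_zero, Fin.succ_pos, Fin.succ_lt_succ_iff,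
      Fin.succ_inj, if_true, if_false, ← Finset.mul_sum, lt_irrefl]
    have h := ih (fun i => a i.succ) (fun i => b i.succ)
    rw [← Finset.abs_prod]
    calc _ = |(a 0 - b 0) * ∏ i : Fin m, b i.succ +
            a 0 * (∏ i : Fin m, a i.succ - ∏ i : Fin m, b i.succ)| := by congr 1; ring
      _ ≤ _ := (abs_add_le _ _).trans ?_
    rw [abs_mul, abs_mul]
    gcongr

lemma sum_prod_ite_le {A B D : ℝ} (hA : 0 ≤ A) (hB : 0 ≤ B) (hD : 0 ≤ D) (m : ℕ) :
    ∑ j : Fin (m + 1), ∏ i, (if i < j then A else if i = j then D else B) ≤ (A + B) ^ m * D := by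
  induction m with
  | zero => simp
  | succ m ih =>
    rw [Fin.sum_univ_succ]
    simp only [Fin.prod_univ_succ (n := m + 1), Fin.not_lt_zero, Fin.succ_ne_zero, Fin.succ_pos,
      Fin.succ_lt_succ_iff, Fin.succ_inj, if_true, if_false, ← Finset.mul_sum,
      Finset.prod_const, Finset.card_univ, Fintype.card_fin]
    have h1 : B ^ m ≤ (A + B) ^ m := by gcongr; linarith
    calc _ ≤ D * (B * (A + B) ^ m) + A * ((A + B) ^ m * D) := by
            rw [pow_succ' B]; gcongr
      _ = _ := by ring

lemma Rregion_subset (k : ℕ) (α : ℝ) :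
    Rregion k α ⊆ (univ.pi fun _ => Icc 0 α) ×ˢ orthantSimplex k (2 * α) := by
  rintro ⟨x, l⟩ ⟨hx, hl, hL, -⟩
  dsimp only at hx hl hL
  have hl0 : ∀ i, 0 ≤ l i := fun i => (abs_nonneg _).trans (hl i).1
  have hx0 := hx ⟨0, by omega⟩
  have hxk := hx ⟨k + 1, by omega⟩
  have hL0 := (abs_nonneg _).trans hL
  obtain ⟨X, hX⟩ : ∃ X : ℕ → ℝ, ∀ m (h : m < k + 2), x ⟨m, h⟩ = X m :=
    ⟨fun m => if h : m < k + 2 then x ⟨m, h⟩ else 0, fun m h => by simp [h]⟩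
  obtain ⟨Λ, hΛ⟩ : ∃ Λ : ℕ → ℝ, ∀ m (h : m < k), l ⟨m, h⟩ = Λ m :=
    ⟨fun m => if h : m < k then l ⟨m, h⟩ else 0, fun m h => by simp [h]⟩
  have hS : ∑ j, l j = ∑ m ∈ Finset.range k, Λ m := by
    rw [Finset.sum_range]
    exact Finset.sum_congr rfl fun j _ => hΛ j j.2
  have hstep : ∀ m < k, |X m - X (m + 1)| ≤ Λ m := fun m hm => by
    have := (hl ⟨m, hm⟩).1
    rw [hΛ] at this
    rw [← hX m (by omega), ← hX (m + 1) (by omega)]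
    exact this
  have hleft : ∀ m ≤ k, X m ≤ X 0 + ∑ j ∈ Finset.range m, Λ j := by
    intro m
    induction m with
    | zero => simp
    | succ m ih =>
      intro hm
      have h1 := ih (by omega)
      have h2 := abs_le.1 (hstep m hm)
      rw [Finset.sum_range_succ]
      linarith [h2.1]
  have hright : ∀ m p, m ≤ p → p ≤ k →
      X m + ∑ j ∈ Finset.range m, Λ j ≤ X p + ∑ j ∈ Finset.range p, Λ j := by
    intro m p hmp
    induction p, hmp using Nat.le_induction with
    | base => simp
    | succ p hmp ih =>
      intro hp
      have h1 := ih (by omega)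
      have h2 := abs_le.1 (hstep p hp)
      rw [Finset.sum_range_succ]
      linarith [h2.2]
  refine ⟨fun i _ => ⟨hx i, ?_⟩, hl0, ?_⟩
  · rw [hS] at hL
    simp only [hX] at hL
    have hL' := abs_le.1 hL
    obtain ⟨m, hm⟩ := i
    change x ⟨m, hm⟩ ≤ α
    rw [hX]
    rcases Nat.lt_succ_iff_lt_or_eq.1 hm with hm | rfl
    · have h1 := hleft m (by omega)
      have h2 := hright m k (by omega) le_rfl
      linarith [hL'.2]
    · have h1 := hleft k le_rfl
      linarith [hL'.1]
  · linarith

/-- Bound (2.8) on the difference of the `A_n` functions of two potentials. -/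
theorem An_diff_bound (q qt : ℝ → ℝ) (hq : IntegrableOn q (Ioi 0))
    (hqt : IntegrableOn qt (Ioi 0)) (n : ℕ) (hn : 2 ≤ n) :
    ∀ α : ℝ, 0 < α →
      |An q n α - An qt n α| ≤
        (Qfun q α + Qfun qt α) ^ (n-1) * (∫ y in Ioc (0:ℝ) α, |q y - qt y|) *
          α ^ (n-2) / (Nat.factorial (n-2)) := by
  intro α hα
  obtain ⟨k, rfl⟩ : ∃ k, n = k + 2 := ⟨n - 2, by omega⟩
  have hAn : ∀ f : ℝ → ℝ, An f (k + 2) α =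
      (-1) ^ (k + 1) / 2 ^ k * ∫ p in Rregion k α, ∏ i, f (p.1 i) := fun f => rfl
  rw [hAn, hAn, show k + 2 - 2 = k by omega, show k + 2 - 1 = k + 1 by omega]
  set μ : Measure ℝ := volume.restrict (Icc 0 α)
  have hμ' : volume.restrict (Ioc 0 α) = μ := restrict_Ioc_eq_restrict_Icc
  set S := orthantSimplex k (2 * α)
  set B : Set ((Fin (k + 2) → ℝ) × (Fin k → ℝ)) := (univ.pi fun _ => Icc 0 α) ×ˢ S with hB
  have hν : volume.restrict B =
      (Measure.pi fun _ : Fin (k + 2) => μ).prod (volume.restrict S) := by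
    rw [hB, Measure.volume_eq_prod, ← Measure.prod_restrict, volume_pi, Measure.restrict_pi_pi]
  have hvol := volume_orthantSimplex_le k (r := 2 * α) (by positivity)
  have hfin : IsFiniteMeasure (volume.restrict S) :=
    ⟨by rw [Measure.restrict_apply_univ]; exact hvol.trans_lt ENNReal.ofReal_lt_top⟩
  have hvol' : (volume.restrict S).real univ ≤ (2 * α) ^ k / k.factorial := by
    rw [measureReal_restrict_apply_univ]
    exact ENNReal.toReal_le_of_le_ofReal (by positivity) hvol
  have hqμ : Integrable q μ := hμ' ▸ hq.mono_set Ioc_subset_Ioi_self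
  have hqtμ : Integrable qt μ := hμ' ▸ hqt.mono_set Ioc_subset_Ioi_self
  have hprod : ∀ f : ℝ → ℝ, Integrable f μ →
      IntegrableOn (fun p : (Fin (k + 2) → ℝ) × (Fin k → ℝ) => ∏ i, f (p.1 i)) B := by
    intro f hf
    rw [IntegrableOn, hν]
    exact (Integrable.fintype_prod (f := fun _ => f) (μ := fun _ => μ) fun _ => hf).comp_fst _
  have hsub : Rregion k α ⊆ B := Rregion_subset k α
  let c : Fin (k + 2) → Fin (k + 2) → ℝ → ℝ := fun j i y =>
    if i < j then |q y| else if i = j then |q y - qt y| else |qt y|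
  have hc : ∀ j i, Integrable (c j i) μ := fun j i => by
    dsimp only [c]
    split_ifs
    exacts [hqμ.abs, (hqμ.sub hqtμ).abs, hqtμ.abs]
  have hcint : ∀ j i, ∫ y, c j i y ∂μ =
      if i < j then Qfun q α else if i = j then ∫ y in Ioc 0 α, |q y - qt y| else Qfun qt α := by
    intro j i
    dsimp only [c, Qfun]
    rw [hμ']
    split_ifs <;> rfl
  let g : (Fin (k + 2) → ℝ) → ℝ := fun x => ∑ j, ∏ i, c j i (x i)
  have hgint : Integrable g (Measure.pi fun _ => μ) :=
    integrable_finsetSum _ fun j _ => Integrable.fintype_prod fun i => hc j i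
  have hgB : IntegrableOn (fun p : (Fin (k + 2) → ℝ) × (Fin k → ℝ) => g p.1) B := by
    rw [IntegrableOn, hν]
    exact hgint.comp_fst _
  have hg : ∫ x, g x ∂(Measure.pi fun _ => μ) ≤
      (Qfun q α + Qfun qt α) ^ (k + 1) * ∫ y in Ioc (0:ℝ) α, |q y - qt y| := by
    dsimp only [g]
    rw [integral_finsetSum _ fun j _ => Integrable.fintype_prod fun i => hc j i]
    simp only [integral_fintype_prod_eq_prod, hcint]
    exact sum_prod_ite_le (integral_nonneg fun _ => abs_nonneg _)
      (integral_nonneg fun _ => abs_nonneg _) (integral_nonneg fun _ => abs_nonneg _) (k + 1)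
  have hgle : ∀ x : Fin (k + 2) → ℝ, |∏ i, q (x i) - ∏ i, qt (x i)| ≤ g x := fun x =>
    abs_prod_sub_prod_le _ (fun i => q (x i)) fun i => qt (x i)
  have hg0 : ∀ x, 0 ≤ g x := fun x => (abs_nonneg _).trans (hgle x)
  have hmain : |∫ p in Rregion k α, (∏ i, q (p.1 i) - ∏ i, qt (p.1 i))| ≤
      (2 * α) ^ k / k.factorial *
        ((Qfun q α + Qfun qt α) ^ (k + 1) * ∫ y in Ioc (0:ℝ) α, |q y - qt y|) := by
    calc |∫ p in Rregion k α, (∏ i, q (p.1 i) - ∏ i, qt (p.1 i))|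
      _ ≤ ∫ p in Rregion k α, g p.1 := by
          rw [← Real.norm_eq_abs]
          exact norm_integral_le_of_norm_le (hgB.mono_set hsub) (ae_of_all _ fun p => hgle p.1)
      _ ≤ ∫ p in B, g p.1 :=
          setIntegral_mono_set hgB (ae_of_all _ fun p => hg0 p.1) hsub.eventuallyLE
      _ = (volume.restrict S).real univ * ∫ x, g x ∂(Measure.pi fun _ => μ) := by
          rw [hν, integral_fun_fst, smul_eq_mul]
      _ ≤ _ := mul_le_mul hvol' hg (integral_nonneg hg0) (by positivity)
  rw [← mul_sub, ← integral_sub ((hprod q hqμ).mono_set hsub) ((hprod qt hqtμ).mono_set hsub),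
    abs_mul, abs_div, abs_pow, abs_neg, abs_one, one_pow, abs_of_pos (by positivity : (0:ℝ) < 2 ^ k)]
  calc _ ≤ 1 / 2 ^ k * ((2 * α) ^ k / k.factorial *
        ((Qfun q α + Qfun qt α) ^ (k + 1) * ∫ y in Ioc (0:ℝ) α, |q y - qt y|)) := by gcongr
    _ = _ := by
      rw [mul_pow]
      field_simp

end
end
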